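/- arXiv:2405.04004 — 4 statements merged into one kernel-verified Lean document; each statement's English description precedes it below -/
import Mathlib

section
/- Let k_1, k_2, k_3 be positive integers with k = k_1+k_2+k_3, and let p_1, p_2, p_3 ≥ 0 be reals with p_1+p_2+p_3 = 1 and p_2 < 1. For n ≥ k, the expected number of (k_1,k_2,k_3) patterns, E_n = Σ_s weight(s)·X(s) (sum over all sequences s of length n over {1,2,3}), equals p_1^{k_1} p_2^{k_2} p_3^{k_3} · [ (n−k+1)/(1−p_2) − p_2 (1 − p_2^{n−k+1})/(1−p_2)^2 ]. -/
/-- States are `Fin ℓ`, with the element of value `i` (0-based) playing the role of the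
state `i+1` of the informal statement.  `OccursAt ℓ n k s j0` says that an occurrence of
the pattern `(k 0, …, k (ℓ-1))` starts at position `j0` in the sequence `s`:
there are `0 ≤ j0 < j1 < ⋯ < jℓ ≤ n` with `j_{i+1} - j_i ≥ k i`, all letters in the
`i`-th block equal to `i`, and either `j0 = 0` or the letter before `j0` differs from
the first state. -/
def OccursAt (ℓ n : ℕ) (k : Fin ℓ → ℕ) (s : Fin n → Fin ℓ) (j0 : ℕ) : Prop :=
  ∃ j : ℕ → ℕ, j 0 = j0 ∧ j ℓ ≤ n ∧
    (∀ i : Fin ℓ, j i.val + k i ≤ j (i.val + 1)) ∧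
    (∀ i : Fin ℓ, ∀ t : ℕ, ∀ ht : t < n,
      j i.val ≤ t → t < j (i.val + 1) → (s ⟨t, ht⟩ : ℕ) = i.val) ∧
    (j0 = 0 ∨ ∃ h : j0 - 1 < n, (s ⟨j0 - 1, h⟩ : ℕ) ≠ 0)

/-- The pattern count `X(s)`: the number of positions at which an occurrence of the
pattern `(k 0, …, k (ℓ-1))` starts. -/
noncomputable def patCount (ℓ n : ℕ) (k : Fin ℓ → ℕ) (s : Fin n → Fin ℓ) : ℕ :=
  {j0 : ℕ | OccursAt ℓ n k s j0}.ncard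

/-- `s` ends with the pattern `(k 0, …, k (ℓ-1))`: it has a suffix
`0^{a_0} 1^{a_1} ⋯ (ℓ-1)^{a_{ℓ-1}}` with `a_i ≥ k i`. -/
def EndsWith (ℓ n : ℕ) (k : Fin ℓ → ℕ) (s : Fin n → Fin ℓ) : Prop :=
  ∃ j : ℕ → ℕ, j ℓ = n ∧
    (∀ i : Fin ℓ, j i.val + k i ≤ j (i.val + 1)) ∧
    (∀ i : Fin ℓ, ∀ t : ℕ, ∀ ht : t < n,
      j i.val ≤ t → t < j (i.val + 1) → (s ⟨t, ht⟩ : ℕ) = i.val)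

/-- The weight of a sequence `s`: the product of the probabilities of its letters. -/
def wt (ℓ n : ℕ) (p : Fin ℓ → ℝ) (s : Fin n → Fin ℓ) : ℝ := ∏ t, p (s t)

/-- `F_{ℓ,n}(w) = Σ_{m≥0} P_{ℓ,n}(m) w^m ∈ ℝ[w]`, where `P_{ℓ,n}(m)` is the total weight
of the sequences of length `n` with pattern count `m`; equivalently
`F_{ℓ,n}(w) = Σ_s weight(s) · w^{X(s)}`. -/
noncomputable def Fpoly (ℓ n : ℕ) (k : Fin ℓ → ℕ) (p : Fin ℓ → ℝ) : Polynomial ℝ :=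
  ∑ s : Fin n → Fin ℓ, Polynomial.C (wt ℓ n p s) * Polynomial.X ^ patCount ℓ n k s

/-- `E_n = Σ_s weight(s) · X(s)`: the expected pattern count in sequences of length `n`. -/
noncomputable def Ewt (ℓ n : ℕ) (k : Fin ℓ → ℕ) (p : Fin ℓ → ℝ) : ℝ :=
  ∑ s : Fin n → Fin ℓ, wt ℓ n p s * (patCount ℓ n k s : ℝ)

open Finset in
/-- The letters allowed at position `t` when the word `0^a 1^b 2^c` is required to appear at
position `u`, all other positions being free. -/
def blockLetters (u a b c t : ℕ) : Finset (Fin 3) :=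
  if t < u then univ else if t < u + a then {0} else if t < u + a + b then {1}
  else if t < u + a + b + c then {2} else univ

/-- The sequences in which the word `0^a 1^b 2^c` appears at position `u`. -/
def blockSeqs (n u a b c : ℕ) : Finset (Fin n → Fin 3) :=
  Fintype.piFinset fun t => blockLetters u a b c t

theorem mem_blockSeqs {n u a b c : ℕ} {s : Fin n → Fin 3} :
    s ∈ blockSeqs n u a b c ↔ ∀ t (ht : t < n),
      (u ≤ t → t < u + a → s ⟨t, ht⟩ = 0) ∧
      (u + a ≤ t → t < u + a + b → s ⟨t, ht⟩ = 1) ∧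
      (u + a + b ≤ t → t < u + a + b + c → s ⟨t, ht⟩ = 2) := by
  rw [blockSeqs, Fintype.mem_piFinset, Fin.forall_iff]
  refine forall₂_congr fun t ht => ?_
  unfold blockLetters
  split_ifs <;> simp <;> grind

theorem sum_wt_blockSeqs {n u a b c : ℕ} (h : u + a + b + c ≤ n) (p : Fin 3 → ℝ)
    (hp : ∑ i, p i = 1) :
    ∑ s ∈ blockSeqs n u a b c, wt 3 n p s = p 0 ^ a * p 1 ^ b * p 2 ^ c := by
  unfold wt blockSeqs
  rw [← Finset.prod_univ_sum (fun t : Fin n => blockLetters u a b c t) (fun _ j => p j),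
    Fin.prod_univ_eq_prod_range (fun t => ∑ j ∈ blockLetters u a b c t, p j) n]
  obtain ⟨r, rfl⟩ := Nat.exists_eq_add_of_le h
  simp only [Finset.prod_range_add]
  have h0 : ∀ t ∈ Finset.range u, ∑ j ∈ blockLetters u a b c t, p j = 1 := by
    intro t ht
    rw [Finset.mem_range] at ht
    simp only [blockLetters, if_pos ht, hp]
  have h1 : ∀ t ∈ Finset.range a, ∑ j ∈ blockLetters u a b c (u + t), p j = p 0 := by
    intro t ht
    rw [Finset.mem_range] at ht
    rw [blockLetters, if_neg (by omega), if_pos (by omega), Finset.sum_singleton]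
  have h2 : ∀ t ∈ Finset.range b, ∑ j ∈ blockLetters u a b c (u + a + t), p j = p 1 := by
    intro t ht
    rw [Finset.mem_range] at ht
    rw [blockLetters, if_neg (by omega), if_neg (by omega), if_pos (by omega),
      Finset.sum_singleton]
  have h3 : ∀ t ∈ Finset.range c, ∑ j ∈ blockLetters u a b c (u + a + b + t), p j = p 2 := by
    intro t ht
    rw [Finset.mem_range] at ht
    rw [blockLetters, if_neg (by omega), if_neg (by omega), if_neg (by omega),
      if_pos (by omega), Finset.sum_singleton]
  have h4 : ∀ t ∈ Finset.range r, ∑ j ∈ blockLetters u a b c (u + a + b + c + t), p j = 1 := by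
    intro t _
    rw [blockLetters, if_neg (by omega), if_neg (by omega), if_neg (by omega),
      if_neg (by omega), hp]
  rw [Finset.prod_congr rfl h0, Finset.prod_congr rfl h1, Finset.prod_congr rfl h2,
    Finset.prod_congr rfl h3, Finset.prod_congr rfl h4]
  simp

/-- The start of the maximal run of the letter `0` that ends just before position `u`. -/
def runStart {n : ℕ} (s : Fin n → Fin 3) : ℕ → ℕ
  | 0 => 0
  | u + 1 => if ∃ h : u < n, s ⟨u, h⟩ = 0 then runStart s u else u + 1

theorem runStart_le {n : ℕ} (s : Fin n → Fin 3) (u : ℕ) : runStart s u ≤ u := by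
  induction u with
  | zero => simp [runStart]
  | succ u ih => rw [runStart]; split_ifs <;> omega

theorem eq_zero_of_runStart_le {n : ℕ} (s : Fin n → Fin 3) (u t : ℕ) (ht : t < n)
    (h : runStart s u ≤ t) (htu : t < u) : s ⟨t, ht⟩ = 0 := by
  induction u with
  | zero => omega
  | succ u ih =>
    rw [runStart] at h
    split_ifs at h with h0
    · obtain rfl | hlt : t = u ∨ t < u := by omega
      · exact h0.2
      · exact ih h hlt
    · omega

theorem runStart_boundary {n : ℕ} (s : Fin n → Fin 3) {u : ℕ} (hu : u ≤ n) :
    runStart s u = 0 ∨ ∃ h : runStart s u - 1 < n, s ⟨runStart s u - 1, h⟩ ≠ 0 := by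
  induction u with
  | zero => exact Or.inl rfl
  | succ u ih =>
    rw [runStart]
    split_ifs with h0
    · exact ih (by omega)
    · exact Or.inr ⟨by omega, fun h => h0 ⟨hu, h⟩⟩

theorem runStart_eq {n : ℕ} (s : Fin n → Fin 3) {u j : ℕ} (hu : u ≤ n) (hj : j ≤ u)
    (hz : ∀ t (ht : t < n), j ≤ t → t < u → s ⟨t, ht⟩ = 0)
    (hb : j = 0 ∨ ∃ h : j - 1 < n, s ⟨j - 1, h⟩ ≠ 0) : runStart s u = j := by
  apply le_antisymm
  · by_contra! hlt
    obtain h | ⟨h, h'⟩ := runStart_boundary s hu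
    · omega
    · exact h' (hz _ h (by omega) (by have := runStart_le s u; omega))
  · by_contra! hlt
    obtain h | ⟨h, h'⟩ := hb
    · omega
    · exact h' (eq_zero_of_runStart_le s u _ h (by omega) (by omega))

theorem occursAt_three_iff {n a b c : ℕ} {s : Fin n → Fin 3} {j : ℕ} :
    OccursAt 3 n ![a, b, c] s j ↔ ∃ j₁ j₂ j₃, j₃ ≤ n ∧ j + a ≤ j₁ ∧ j₁ + b ≤ j₂ ∧ j₂ + c ≤ j₃ ∧
      (∀ t (ht : t < n), (j ≤ t → t < j₁ → s ⟨t, ht⟩ = 0) ∧ (j₁ ≤ t → t < j₂ → s ⟨t, ht⟩ = 1) ∧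
        (j₂ ≤ t → t < j₃ → s ⟨t, ht⟩ = 2)) ∧
      (j = 0 ∨ ∃ h : j - 1 < n, s ⟨j - 1, h⟩ ≠ 0) := by
  constructor
  · rintro ⟨f, rfl, hn, hk, hs, hb⟩
    refine ⟨f 1, f 2, f 3, hn, hk 0, hk 1, hk 2, fun t ht => ⟨fun h h' => ?_, fun h h' => ?_,
      fun h h' => ?_⟩, ?_⟩
    · exact Fin.ext (hs 0 t ht h h')
    · exact Fin.ext (hs 1 t ht h h')
    · exact Fin.ext (hs 2 t ht h h')
    · exact hb.imp_right fun ⟨h, h'⟩ => ⟨h, fun e => h' (by rw [e]; rfl)⟩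
  · rintro ⟨j₁, j₂, j₃, hn, h1, h2, h3, hs, hb⟩
    refine ⟨fun i => if i = 0 then j else if i = 1 then j₁ else if i = 2 then j₂ else j₃,
      rfl, hn, ?_, ?_, ?_⟩
    · intro i
      fin_cases i
      exacts [h1, h2, h3]
    · intro i t ht h h'
      fin_cases i
      · exact congrArg Fin.val ((hs t ht).1 h h')
      · exact congrArg Fin.val ((hs t ht).2.1 h h')
      · exact congrArg Fin.val ((hs t ht).2.2 h h')
    · exact hb.imp_right fun ⟨h, h'⟩ => ⟨h, fun e => h' (Fin.ext e)⟩

/-- Indices `⟨m, d⟩` of the words `0^a 1^(b+d) 2^c` at position `N - m` that fit into a sequence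
of length `a + b + c + N`. -/
def placements (N : ℕ) : Finset (Σ _ : ℕ, ℕ) :=
  (Finset.range (N + 1)).sigma fun m => Finset.range (m + 1)

theorem patCount_three {a b c N : ℕ} (hb : 0 < b) (hc : 0 < c)
    (s : Fin (a + b + c + N) → Fin 3) :
    patCount 3 (a + b + c + N) ![a, b, c] s =
      Finset.card {x ∈ placements N | s ∈ blockSeqs (a + b + c + N) (N - x.1) a (b + x.2) c} := by
  rw [patCount, ← Set.ncard_coe_finset]
  symm
  refine Set.ncard_congr (fun x _ => runStart s (N - x.1)) ?_ ?_ ?_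
  · rintro ⟨m, d⟩ hx
    simp only [placements, Finset.coe_filter, Finset.mem_sigma, Finset.mem_range,
      Set.mem_ofPred_eq, mem_blockSeqs] at hx ⊢
    obtain ⟨⟨hm, hd⟩, hs⟩ := hx
    have hle := runStart_le s (N - m)
    rw [occursAt_three_iff]
    refine ⟨N - m + a, N - m + a + (b + d), N - m + a + (b + d) + c, by omega, by omega,
      by omega, by omega, fun t ht => ⟨fun h h' => ?_, (hs t ht).2⟩,
      runStart_boundary s (by omega)⟩
    by_cases htu : t < N - m
    · exact eq_zero_of_runStart_le s _ t ht h htu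
    · exact (hs t ht).1 (by omega) h'
  · have key : ∀ m d m' d', m < N + 1 → d < m + 1 → m' < N + 1 → d' < m' + 1 →
        s ∈ blockSeqs (a + b + c + N) (N - m) a (b + d) c →
        s ∈ blockSeqs (a + b + c + N) (N - m') a (b + d') c →
        runStart s (N - m) = runStart s (N - m') → m ≤ m' ∧ (m = m' → d' ≤ d) := by
      intro m d m' d' hm hd hm' hd' hs hs' he
      rw [mem_blockSeqs] at hs hs'
      have hle := runStart_le s (N - m)
      constructor
      · by_contra! hlt
        have h1 := (hs (N - m + a) (by omega)).2.1 (by omega) (by omega)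
        have h0 : s ⟨N - m + a, by omega⟩ = 0 := by
          by_cases htu : N - m + a < N - m'
          · exact eq_zero_of_runStart_le s (N - m') _ _ (by omega) htu
          · exact (hs' _ _).1 (by omega) (by omega)
        rw [h0] at h1
        exact absurd h1 (by decide)
      · rintro rfl
        by_contra! hlt
        have h1 := (hs (N - m + a + (b + d)) (by omega)).2.2 (by omega) (by omega)
        have h2 := (hs' (N - m + a + (b + d)) (by omega)).2.1 (by omega) (by omega)
        rw [h2] at h1
        exact absurd h1 (by decide)
    rintro ⟨m, d⟩ ⟨m', d'⟩ hx hx' he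
    simp only [placements, Finset.coe_filter, Finset.mem_sigma, Finset.mem_range,
      Set.mem_ofPred_eq] at hx hx' he
    obtain ⟨⟨hm, hd⟩, hs⟩ := hx
    obtain ⟨⟨hm', hd'⟩, hs'⟩ := hx'
    have h1 := key m d m' d' hm hd hm' hd' hs hs' he
    have h2 := key m' d' m d hm' hd' hm hd hs' hs he.symm
    obtain rfl : m = m' := by omega
    obtain rfl : d = d' := by have := h1.2 rfl; have := h2.2 rfl; omega
    rfl
  · intro j hj
    rw [Set.mem_ofPred_eq, occursAt_three_iff] at hj
    obtain ⟨j₁, j₂, j₃, hn, h1, h2, h3, hs, hbd⟩ := hj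
    have hu : N - (N + a - j₁) = j₁ - a := by omega
    refine ⟨⟨N + a - j₁, j₂ - j₁ - b⟩, ?_, ?_⟩
    · simp only [placements, Finset.coe_filter, Finset.mem_sigma, Finset.mem_range,
        Set.mem_ofPred_eq, mem_blockSeqs, hu]
      refine ⟨by omega, fun t ht => ⟨fun h h' => ?_, fun h h' => ?_, fun h h' => ?_⟩⟩
      · exact (hs t ht).1 (by omega) (by omega)
      · exact (hs t ht).2.1 (by omega) (by omega)
      · exact (hs t ht).2.2 (by omega) (by omega)
    · simp only [hu]
      exact runStart_eq s (by omega) (by omega)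
        (fun t ht h h' => (hs t ht).1 h (by omega)) hbd

theorem sum_range_geom_sum {q : ℝ} (hq : q ≠ 1) (M : ℕ) :
    ∑ m ∈ Finset.range M, ∑ d ∈ Finset.range (m + 1), q ^ d =
      M / (1 - q) - q * (1 - q ^ M) / (1 - q) ^ 2 := by
  have hq' : 1 - q ≠ 0 := sub_ne_zero.2 hq.symm
  induction M with
  | zero => simp
  | succ M ih =>
    have hg : ∑ d ∈ Finset.range (M + 1), q ^ d = (1 - q ^ (M + 1)) / (1 - q) := by
      rw [eq_div_iff hq', geom_sum_mul_neg]
    rw [Finset.sum_range_succ, ih, hg]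
    push_cast
    field_simp
    ring

theorem statement4 (k₁ k₂ k₃ : ℕ) (hk₁ : 0 < k₁) (hk₂ : 0 < k₂) (hk₃ : 0 < k₃)
    (p₁ p₂ p₃ : ℝ) (hp₁ : 0 ≤ p₁) (hp₂ : 0 ≤ p₂) (hp₃ : 0 ≤ p₃)
    (hsum : p₁ + p₂ + p₃ = 1) (hp₂lt : p₂ < 1)
    (n : ℕ) (hn : k₁ + k₂ + k₃ ≤ n) :
    Ewt 3 n ![k₁, k₂, k₃] ![p₁, p₂, p₃] =
      p₁ ^ k₁ * p₂ ^ k₂ * p₃ ^ k₃ *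
        (((n : ℝ) - ((k₁ : ℝ) + k₂ + k₃) + 1) / (1 - p₂) -
          p₂ * (1 - p₂ ^ (n - (k₁ + k₂ + k₃) + 1)) / (1 - p₂) ^ 2) := by
  obtain ⟨N, rfl⟩ := Nat.exists_eq_add_of_le hn
  have hp : ∑ i, ![p₁, p₂, p₃] i = 1 := by simpa [Fin.sum_univ_three] using hsum
  have hsub : k₁ + k₂ + k₃ + N - (k₁ + k₂ + k₃) + 1 = N + 1 := by omega
  have hcast : ((k₁ + k₂ + k₃ + N : ℕ) : ℝ) - ((k₁ : ℝ) + k₂ + k₃) + 1 = (N + 1 : ℕ) := by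
    push_cast
    ring
  rw [hsub, hcast, ← sum_range_geom_sum hp₂lt.ne, Ewt]
  simp only [patCount_three hk₂ hk₃, Finset.card_filter, Nat.cast_sum, Nat.cast_ite,
    Nat.cast_one, Nat.cast_zero, Finset.mul_sum, mul_ite, mul_one, mul_zero]
  rw [Finset.sum_comm, placements, Finset.sum_sigma]
  refine Finset.sum_congr rfl fun m hm => Finset.sum_congr rfl fun d hd => ?_
  rw [Finset.mem_range] at hm hd
  rw [← Finset.sum_filter, Finset.filter_univ_mem, sum_wt_blockSeqs (by dsimp only; omega) _ hp]
  simp only [Matrix.cons_val]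
  ring
end

section
/- Let ℓ ≥ 2 be an integer and k_1,…,k_ℓ positive integers with k = k_1+⋯+k_ℓ. Let b_n denote the NUMBER of sequences of length n over {1,…,ℓ} that end with the pattern (k_1,…,k_ℓ), and let H̃_ℓ(z) = Σ_{n≥1} b_n z^n, a formal power series over ℤ. Then H̃_ℓ(z) · (1 − z)^{ℓ−1} (1 − ℓ z) = z^{k}. -/
/-- `b_n`: the number of sequences of length `n` that end with the pattern. -/
noncomputable def endCount (ℓ n : ℕ) (k : Fin ℓ → ℕ) : ℕ :=
  {s : Fin n → Fin ℓ | EndsWith ℓ n k s}.ncard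

/-- The words over `Fin ℓ` with a suffix `0^{a_0} 1^{a_1} ⋯ (m-1)^{a_{m-1}}`, `a_i ≥ k i`. -/
def patternWords (ℓ : ℕ) (k : Fin ℓ → ℕ) : ℕ → Set (List (Fin ℓ))
  | 0 => Set.univ
  | m + 1 => {v | ∃ h : m < ℓ, ∃ a, k ⟨m, h⟩ ≤ a ∧ ∃ w ∈ patternWords ℓ k m,
      v = w ++ List.replicate a ⟨m, h⟩}

/-- The generating function of a set of words, counted by length. -/
noncomputable def wordSeries {α : Type*} (A : Set (List α)) : PowerSeries ℤ :=
  PowerSeries.mk fun n => ({w | w ∈ A ∧ w.length = n}.ncard : ℤ)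

theorem wordSeries_univ_mul {α : Type*} [Fintype α] :
    wordSeries (Set.univ : Set (List α)) *
      (1 - (Fintype.card α : PowerSeries ℤ) * PowerSeries.X) = 1 := by
  have hc : ∀ n, ({w : List α | w ∈ Set.univ ∧ w.length = n}.ncard) = Fintype.card α ^ n := by
    intro n
    rw [← card_vector n, ← Nat.card_eq_fintype_card, ← Nat.card_coe_set_eq]
    exact Nat.card_congr (Equiv.subtypeEquivRight (by simp))
  have hcoeff : ∀ n, PowerSeries.coeff n (wordSeries (Set.univ : Set (List α))) =
      (Fintype.card α : ℤ) ^ n := by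
    intro n
    rw [wordSeries, PowerSeries.coeff_mk, hc, Nat.cast_pow]
  have hcast : (Fintype.card α : PowerSeries ℤ) = PowerSeries.C (Fintype.card α : ℤ) := by simp
  ext n
  rw [mul_sub, mul_one, hcast, mul_left_comm, map_sub, PowerSeries.coeff_C_mul, hcoeff]
  cases n with
  | zero => simp
  | succ n =>
    rw [PowerSeries.coeff_succ_mul_X, hcoeff]
    simp [PowerSeries.coeff_one, pow_succ, mul_comm]

theorem wordSeries_image_concat {α : Type*} (A : Set (List α)) (x : α) :
    wordSeries ((fun w => w ++ [x]) '' A) = wordSeries A * PowerSeries.X := by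
  ext n
  cases n with
  | zero =>
    have : {w | w ∈ (fun w => w ++ [x]) '' A ∧ w.length = 0} = ∅ := by
      ext w
      simp only [Set.mem_image, Set.mem_ofPred_eq, Set.mem_empty_iff_false, iff_false]
      rintro ⟨⟨u, -, rfl⟩, h⟩
      simp at h
    rw [wordSeries, PowerSeries.coeff_mk, this]
    simp
  | succ n =>
    have : {w | w ∈ (fun w => w ++ [x]) '' A ∧ w.length = n + 1} =
        (fun w => w ++ [x]) '' {w | w ∈ A ∧ w.length = n} := by
      ext w
      constructor
      · rintro ⟨⟨u, hu, rfl⟩, h⟩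
        exact ⟨u, ⟨hu, by simpa using h⟩, rfl⟩
      · rintro ⟨u, ⟨hu, h⟩, rfl⟩
        exact ⟨⟨u, hu, rfl⟩, by simpa using h⟩
    rw [PowerSeries.coeff_succ_mul_X]
    simp only [wordSeries, PowerSeries.coeff_mk, this]
    rw [Set.ncard_image_of_injective _ (List.append_left_injective [x])]

theorem wordSeries_image_append_replicate {α : Type*} (A : Set (List α)) (x : α) (a : ℕ) :
    wordSeries ((fun w => w ++ List.replicate a x) '' A) =
      wordSeries A * PowerSeries.X ^ a := by
  induction a with
  | zero => simp
  | succ a ih =>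
    rw [pow_succ, ← mul_assoc, ← ih, ← wordSeries_image_concat _ x, Set.image_image]
    simp [List.replicate_succ']

theorem wordSeries_union {α : Type*} [Finite α] {A B : Set (List α)} (h : Disjoint A B) :
    wordSeries (A ∪ B) = wordSeries A + wordSeries B := by
  ext n
  have hfin : ∀ C : Set (List α), {w | w ∈ C ∧ w.length = n}.Finite := fun C =>
    (List.finite_length_eq α n).subset fun w hw => hw.2
  have hun : {w | w ∈ A ∪ B ∧ w.length = n} =
      {w | w ∈ A ∧ w.length = n} ∪ {w | w ∈ B ∧ w.length = n} := by
    ext w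
    simp [or_and_right]
  have hd : Disjoint {w | w ∈ A ∧ w.length = n} {w | w ∈ B ∧ w.length = n} :=
    h.mono (fun w hw => hw.1) (fun w hw => hw.1)
  simp only [wordSeries, PowerSeries.coeff_mk, map_add, hun]
  rw [Set.ncard_union_eq hd (hfin A) (hfin B), Nat.cast_add]

/-- If no word of `A` ends with `x`, then the words `w x^a` with `w ∈ A` are counted by
`wordSeries A / (1 - X)`. -/
theorem wordSeries_append_replicates {α : Type*} [Finite α] {A : Set (List α)} {x : α}
    (hA : ∀ w, w ++ [x] ∉ A) :
    wordSeries {v | ∃ a, ∃ w ∈ A, v = w ++ List.replicate a x} * (1 - PowerSeries.X) =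
      wordSeries A := by
  set S := {v | ∃ a, ∃ w ∈ A, v = w ++ List.replicate a x} with hS
  have hdec : S = A ∪ (fun w => w ++ [x]) '' S := by
    ext v
    constructor
    · rintro ⟨a, w, hw, rfl⟩
      cases a with
      | zero => left; simpa using hw
      | succ a =>
        right
        exact ⟨w ++ List.replicate a x, ⟨a, w, hw, rfl⟩, by simp [List.replicate_succ']⟩
    · rintro (hv | ⟨_, ⟨a, w, hw, rfl⟩, rfl⟩)
      · exact ⟨0, v, hv, by simp⟩
      · exact ⟨a + 1, w, hw, by simp [List.replicate_succ']⟩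
  have hdisj : Disjoint A ((fun w => w ++ [x]) '' S) := by
    rw [Set.disjoint_left]
    rintro _ h ⟨w, -, rfl⟩
    exact hA w h
  have key : wordSeries S = wordSeries A + wordSeries S * PowerSeries.X := by
    rw [← wordSeries_image_concat S x, ← wordSeries_union hdisj, ← hdec]
  rw [mul_sub, mul_one, sub_eq_iff_eq_add]
  exact key

theorem patternWords_succ (ℓ : ℕ) (k : Fin ℓ → ℕ) (m : ℕ) (h : m < ℓ) :
    patternWords ℓ k (m + 1) = (fun w => w ++ List.replicate (k ⟨m, h⟩) ⟨m, h⟩) ''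
      {v | ∃ a, ∃ w ∈ patternWords ℓ k m, v = w ++ List.replicate a ⟨m, h⟩} := by
  ext v
  constructor
  · rintro ⟨_, a, ha, w, hw, rfl⟩
    refine ⟨w ++ List.replicate (a - k ⟨m, h⟩) ⟨m, h⟩, ⟨_, w, hw, rfl⟩, ?_⟩
    simp only [List.append_assoc, List.replicate_append_replicate]
    rw [Nat.sub_add_cancel ha]
  · rintro ⟨_, ⟨a, w, hw, rfl⟩, rfl⟩
    refine ⟨h, a + k ⟨m, h⟩, Nat.le_add_left _ _, w, hw, ?_⟩
    simp only [List.append_assoc, List.replicate_append_replicate]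

theorem concat_notMem_patternWords (ℓ : ℕ) (k : Fin ℓ → ℕ) (hk : ∀ i, 0 < k i) (m : ℕ)
    (x : Fin ℓ) (hx : x.val ≠ m) (w : List (Fin ℓ)) :
    w ++ [x] ∉ patternWords ℓ k (m + 1) := by
  rintro ⟨h, a, ha, u, -, he⟩
  obtain ⟨b, rfl⟩ := Nat.exists_eq_succ_of_ne_zero ((hk ⟨m, h⟩).trans_le ha).ne'
  rw [Nat.succ_eq_add_one, List.replicate_succ', ← List.append_assoc] at he
  have := (List.append_inj' he rfl).2
  simp only [List.cons.injEq, and_true] at this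
  exact hx (by rw [this])

theorem wordSeries_patternWords (ℓ : ℕ) (k : Fin ℓ → ℕ) (hk : ∀ i, 0 < k i) (m : ℕ)
    (hm : m + 1 ≤ ℓ) :
    wordSeries (patternWords ℓ k (m + 1)) *
      ((1 - PowerSeries.X) ^ m * (1 - (ℓ : PowerSeries ℤ) * PowerSeries.X)) =
      PowerSeries.X ^ (∑ i : Fin (m + 1), k (Fin.castLE hm i)) := by
  induction m with
  | zero =>
    have huniv : {v | ∃ a, ∃ w ∈ patternWords ℓ k 0,
        v = w ++ List.replicate a (⟨0, hm⟩ : Fin ℓ)} = Set.univ :=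
      Set.eq_univ_of_forall fun v => ⟨0, v, trivial, by simp⟩
    have hone := wordSeries_univ_mul (α := Fin ℓ)
    rw [Fintype.card_fin] at hone
    rw [patternWords_succ ℓ k 0 hm, wordSeries_image_append_replicate, huniv, pow_zero, one_mul,
      mul_right_comm, hone, one_mul]
    simp [Fin.castLE]
  | succ m ih =>
    have hstep := wordSeries_append_replicates
      (concat_notMem_patternWords ℓ k hk m ⟨m + 1, hm⟩ (Nat.succ_ne_self m))
    rw [patternWords_succ ℓ k (m + 1) hm, wordSeries_image_append_replicate,
      Fin.sum_univ_castSucc, pow_add PowerSeries.X]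
    have ih' := ih (Nat.le_of_succ_le hm)
    rw [← hstep] at ih'
    have hsum : ∑ i : Fin (m + 1), k (Fin.castLE hm i.castSucc) =
        ∑ i : Fin (m + 1), k (Fin.castLE (Nat.le_of_succ_le hm) i) := rfl
    rw [hsum, ← ih']
    have hlast : Fin.castLE hm (Fin.last (m + 1)) = ⟨m + 1, hm⟩ := rfl
    rw [hlast]
    ring

theorem mem_patternWords_iff (ℓ : ℕ) (k : Fin ℓ → ℕ) (m : ℕ) (hm : m ≤ ℓ)
    (w : List (Fin ℓ)) :
    w ∈ patternWords ℓ k m ↔ ∃ j : ℕ → ℕ, j m = w.length ∧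
      (∀ i : Fin ℓ, i.val < m → j i.val + k i ≤ j (i.val + 1)) ∧
      (∀ i : Fin ℓ, i.val < m → ∀ t : ℕ, ∀ ht : t < w.length,
        j i.val ≤ t → t < j (i.val + 1) → w[t] = i) := by
  induction m generalizing w with
  | zero => exact ⟨fun _ => ⟨fun _ => w.length, rfl, by simp, by simp⟩, fun _ => trivial⟩
  | succ m ih =>
    have hm' : m < ℓ := hm
    constructor
    · rintro ⟨h, a, ha, u, hu, rfl⟩
      obtain ⟨j, hj, hjk, hjw⟩ := (ih hm'.le u).1 hu
      have hmono : ∀ d i, i + d = m → j i ≤ j m := by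
        intro d
        induction d with
        | zero => rintro i rfl; rfl
        | succ d ihd =>
          intro i hi
          have h1 := hjk ⟨i, by omega⟩ (by simp only; omega)
          have h2 := ihd (i + 1) (by omega)
          simp only at h1
          omega
      refine ⟨fun i => if i ≤ m then j i else u.length + a, by simp, ?_, ?_⟩
      · intro i hi
        rcases Nat.lt_succ_iff_lt_or_eq.1 hi with hi | hi
        · simpa [hi.le, Nat.succ_le_of_lt hi] using hjk i hi
        · obtain rfl : i = ⟨m, h⟩ := Fin.ext hi
          simp [hj, ha]
      · intro i hi t ht h1 h2
        rcases Nat.lt_succ_iff_lt_or_eq.1 hi with hi | hi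
        · beta_reduce at h1 h2
          rw [if_pos hi.le] at h1
          rw [if_pos (Nat.succ_le_of_lt hi)] at h2
          have h3 := hmono (m - (i.val + 1)) (i.val + 1) (by omega)
          have htu : t < u.length := by omega
          rw [List.getElem_append_left htu]
          exact hjw i hi t htu h1 h2
        · obtain rfl : i = ⟨m, h⟩ := Fin.ext hi
          simp only [le_refl, if_true, hj] at h1
          rw [List.getElem_append_right h1, List.getElem_replicate]
    · rintro ⟨j, hj, hjk, hjw⟩
      have hlast : j m + k ⟨m, hm'⟩ ≤ j (m + 1) := hjk ⟨m, hm'⟩ (Nat.lt_succ_self m)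
      have hle : j m ≤ w.length := by omega
      refine ⟨hm', w.length - j m, by omega, w.take (j m), ?_, ?_⟩
      · refine (ih hm'.le _).2 ⟨j, by simp [hle], fun i hi => hjk i (hi.trans (Nat.lt_succ_self m)),
          fun i hi t ht h1 h2 => ?_⟩
        rw [List.getElem_take]
        exact hjw i (hi.trans (Nat.lt_succ_self m)) t _ h1 h2
      · refine List.ext_getElem (by simp; omega) fun t h1 h2 => ?_
        rcases lt_or_ge t (j m) with ht | ht
        · rw [List.getElem_append_left (by simp [ht, h1]), List.getElem_take]
        · rw [List.getElem_append_right (by simp [ht]), List.getElem_replicate]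
          exact hjw ⟨m, hm'⟩ (Nat.lt_succ_self m) t h1 ht (by simp only; omega)

theorem endsWith_iff_ofFn_mem (ℓ n : ℕ) (k : Fin ℓ → ℕ) (s : Fin n → Fin ℓ) :
    EndsWith ℓ n k s ↔ List.ofFn s ∈ patternWords ℓ k ℓ := by
  rw [mem_patternWords_iff ℓ k ℓ le_rfl]
  simp [EndsWith, Fin.ext_iff]

theorem endCount_eq_ncard (ℓ n : ℕ) (k : Fin ℓ → ℕ) :
    endCount ℓ n k = {w | w ∈ patternWords ℓ k ℓ ∧ w.length = n}.ncard := by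
  have : {w | w ∈ patternWords ℓ k ℓ ∧ w.length = n} =
      List.ofFn '' {s : Fin n → Fin ℓ | EndsWith ℓ n k s} := by
    ext w
    constructor
    · rintro ⟨hw, rfl⟩
      exact ⟨w.get, (endsWith_iff_ofFn_mem _ _ _ _).2 (by rwa [List.ofFn_get]), List.ofFn_get w⟩
    · rintro ⟨s, hs, rfl⟩
      exact ⟨(endsWith_iff_ofFn_mem _ _ _ _).1 hs, List.length_ofFn⟩
  rw [this, Set.ncard_image_of_injective _ List.ofFn_injective, endCount]

theorem statement6 (ℓ : ℕ) (hℓ : 2 ≤ ℓ) (k : Fin ℓ → ℕ) (hk : ∀ i, 0 < k i) :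
    (PowerSeries.mk fun n => (endCount ℓ n k : ℤ)) *
      ((1 - PowerSeries.X) ^ (ℓ - 1) *
        (1 - (ℓ : PowerSeries ℤ) * PowerSeries.X)) =
      PowerSeries.X ^ (∑ i, k i) := by
  obtain ⟨m, rfl⟩ : ∃ m, ℓ = m + 1 := ⟨ℓ - 1, by omega⟩
  simp only [endCount_eq_ncard]
  exact wordSeries_patternWords (m + 1) k hk m le_rfl
end

section
/- Let ℓ = 3, let k_1, k_2, k_3 be positive integers with k = k_1+k_2+k_3, and let p_1, p_2, p_3 ≥ 0 be reals with p_1+p_2+p_3 = 1. Then for all n ≥ k, F_{3,n}(w) = (1 + p_2) F_{3,n−1}(w) − p_2 F_{3,n−2}(w) + (w−1) p_1^{k_1} p_2^{k_2} p_3^{k_3} F_{3,n−k}(w) as polynomials in w. -/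
/-- The list `r` begins with at least `m` copies of `v`. -/
def BeginsWithRun (v : Fin 3) (m : ℕ) (r : List (Fin 3)) : Prop :=
  ∀ t < m, r[t]? = some v

theorem beginsWithRun_zero (v : Fin 3) (r : List (Fin 3)) : BeginsWithRun v 0 r := by
  intro t ht
  omega

theorem not_beginsWithRun_nil (v : Fin 3) (m : ℕ) : ¬ BeginsWithRun v (m + 1) [] := by
  intro h
  simpa using h 0 (by omega)

theorem beginsWithRun_cons {v c : Fin 3} {m : ℕ} {r : List (Fin 3)} :
    BeginsWithRun v (m + 1) (c :: r) ↔ c = v ∧ BeginsWithRun v m r := by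
  constructor
  · intro h
    refine ⟨by simpa using h 0 (by omega), fun t ht => ?_⟩
    simpa using h (t + 1) (by omega)
  · rintro ⟨rfl, h⟩ t ht
    cases t with
    | zero => simp
    | succ t => simpa using h t (by omega)

theorem BeginsWithRun.eq_append {v : Fin 3} {m : ℕ} {r : List (Fin 3)}
    (h : BeginsWithRun v m r) : r = List.replicate m v ++ r.drop m := by
  induction m generalizing r with
  | zero => simp
  | succ m ih =>
    cases r with
    | nil => exact absurd h (not_beginsWithRun_nil v m)
    | cons c r =>
      obtain ⟨rfl, h⟩ := beginsWithRun_cons.1 h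
      simpa [List.replicate_succ] using ih h

/-- The reversed word `r` begins with a run of at least `b` letters `1`, followed by `k₁`
letters `0`. -/
def BeginsWithOnesZeros (k₁ b : ℕ) (r : List (Fin 3)) : Prop :=
  ∃ a, b ≤ a ∧ BeginsWithRun 1 a r ∧ BeginsWithRun 0 k₁ (r.drop a)

/-- The last letter of the word with reversal `r` completes a new occurrence of the pattern. -/
def Completes (k₁ k₂ k₃ : ℕ) (r : List (Fin 3)) : Prop :=
  BeginsWithRun 2 k₃ r ∧ BeginsWithOnesZeros k₁ k₂ (r.drop k₃)

theorem BeginsWithRun.add_iff {v : Fin 3} {a b : ℕ} {r : List (Fin 3)} :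
    BeginsWithRun v (a + b) r ↔ BeginsWithRun v a r ∧ BeginsWithRun v b (r.drop a) := by
  constructor
  · intro h
    refine ⟨fun t ht => h t (by omega), fun t ht => ?_⟩
    rw [List.getElem?_drop]
    exact h _ (by omega)
  · rintro ⟨h1, h2⟩ t ht
    by_cases hta : t < a
    · exact h1 t hta
    · have := h2 (t - a) (by omega)
      rwa [List.getElem?_drop, Nat.add_sub_cancel' (by omega)] at this

theorem beginsWithOnesZeros_add {k₁ b c : ℕ} {r : List (Fin 3)} :
    BeginsWithOnesZeros k₁ (b + c) r ↔
      BeginsWithRun 1 b r ∧ BeginsWithOnesZeros k₁ c (r.drop b) := by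
  constructor
  · rintro ⟨a, ha, h1, h0⟩
    obtain ⟨a, rfl⟩ := Nat.exists_eq_add_of_le (show b ≤ a by omega)
    rw [BeginsWithRun.add_iff] at h1
    exact ⟨h1.1, a, by omega, h1.2, by rwa [List.drop_drop]⟩
  · rintro ⟨hb, a, ha, h1, h0⟩
    exact ⟨b + a, by omega, BeginsWithRun.add_iff.2 ⟨hb, h1⟩, by rwa [List.drop_drop] at h0⟩

theorem beginsWithOnesZeros_zero {k₁ : ℕ} {r : List (Fin 3)} :
    BeginsWithOnesZeros k₁ 0 r ↔ BeginsWithOnesZeros k₁ 1 r ∨ BeginsWithRun 0 k₁ r := by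
  constructor
  · rintro ⟨a, -, h1, h0⟩
    cases a with
    | zero => exact Or.inr h0
    | succ a => exact Or.inl ⟨a + 1, by omega, h1, h0⟩
  · rintro (⟨a, -, h⟩ | h)
    · exact ⟨a, by omega, h⟩
    · exact ⟨0, le_rfl, beginsWithRun_zero _ _, h⟩

open Classical in
/-- The pattern count of a word, computed recursively from its reversal. -/
noncomputable def revCount (k₁ k₂ k₃ : ℕ) : List (Fin 3) → ℕ
  | [] => 0
  | c :: r => revCount k₁ k₂ k₃ r + if Completes k₁ k₂ k₃ (c :: r) then 1 else 0

theorem revCount_cons_of_ne_two {k₁ k₂ k₃ : ℕ} (hk₃ : 0 < k₃) {c : Fin 3} (hc : c ≠ 2)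
    (r : List (Fin 3)) : revCount k₁ k₂ k₃ (c :: r) = revCount k₁ k₂ k₃ r := by
  rw [revCount, if_neg, Nat.add_zero]
  intro h
  exact hc (by simpa using h.1 0 hk₃)

theorem revCount_replicate_append_of_ne_two {k₁ k₂ k₃ : ℕ} (hk₃ : 0 < k₃) {c : Fin 3}
    (hc : c ≠ 2) (m : ℕ) (r : List (Fin 3)) :
    revCount k₁ k₂ k₃ (List.replicate m c ++ r) = revCount k₁ k₂ k₃ r := by
  induction m with
  | zero => simp
  | succ m ih => rw [List.replicate_succ, List.cons_append, revCount_cons_of_ne_two hk₃ hc, ih]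

theorem revCount_drop_of_beginsWithRun {k₁ k₂ k₃ : ℕ} (hk₃ : 0 < k₃) {c : Fin 3}
    (hc : c ≠ 2) {m : ℕ} {r : List (Fin 3)} (h : BeginsWithRun c m r) :
    revCount k₁ k₂ k₃ (r.drop m) = revCount k₁ k₂ k₃ r := by
  conv_rhs => rw [h.eq_append]
  rw [revCount_replicate_append_of_ne_two hk₃ hc]

theorem revCount_replicate_two_append {k₁ k₂ k₃ m : ℕ} (hm : m < k₃) {r : List (Fin 3)}
    (hr : r[0]? ≠ some 2) :
    revCount k₁ k₂ k₃ (List.replicate m 2 ++ r) = revCount k₁ k₂ k₃ r := by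
  induction m with
  | zero => simp
  | succ m ih =>
    rw [List.replicate_succ, List.cons_append, revCount, if_neg, Nat.add_zero, ih (by omega)]
    intro h
    apply hr
    have := h.1 (m + 1) hm
    rwa [List.getElem?_cons_succ, List.getElem?_append_right (by simp), List.length_replicate,
      Nat.sub_self] at this

theorem Completes.revCount_tail {k₁ k₂ k₃ : ℕ} (hk₂ : 0 < k₂) (hk₃ : 0 < k₃)
    {r : List (Fin 3)} (h : Completes k₁ k₂ k₃ r) :
    revCount k₁ k₂ k₃ r.tail = revCount k₁ k₂ k₃ (r.drop k₃) := by
  obtain ⟨h2, a, ha, h1, -⟩ := h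
  obtain ⟨m, rfl⟩ : ∃ m, k₃ = m + 1 := ⟨k₃ - 1, by omega⟩
  have hr : r.tail = List.replicate m 2 ++ r.drop (m + 1) := by
    conv_lhs => rw [h2.eq_append, List.replicate_succ, List.cons_append, List.tail_cons]
  rw [hr, revCount_replicate_two_append (by omega)]
  rw [h1 0 (by omega)]
  simp

section WordSum

variable {R : Type*} [CommRing R]

/-- The weighted sum of `f` over all reversed words of length `n`, where the letter `c` has
weight `q c`. -/
def wordSum (q : Fin 3 → R) : ℕ → (List (Fin 3) → R) → R
  | 0, f => f []
  | n + 1, f => ∑ c, q c * wordSum q n fun r => f (c :: r)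

theorem wordSum_add (q : Fin 3 → R) (n : ℕ) (f g : List (Fin 3) → R) :
    wordSum q n (fun r => f r + g r) = wordSum q n f + wordSum q n g := by
  induction n generalizing f g with
  | zero => rfl
  | succ n ih => simp only [wordSum, ih, mul_add, Finset.sum_add_distrib]

theorem wordSum_mul_left (q : Fin 3 → R) (n : ℕ) (x : R) (f : List (Fin 3) → R) :
    wordSum q n (fun r => x * f r) = x * wordSum q n f := by
  induction n generalizing f with
  | zero => rfl
  | succ n ih => simp only [wordSum, ih, Finset.mul_sum, mul_left_comm]

theorem wordSum_zero (q : Fin 3 → R) (n : ℕ) : wordSum q n (fun _ => 0) = 0 := by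
  simpa using wordSum_mul_left q n 0 fun _ => 0

theorem wordSum_tail (q : Fin 3 → R) (hq : ∑ c, q c = 1) (n : ℕ) (f : List (Fin 3) → R) :
    wordSum q (n + 1) (fun r => f r.tail) = wordSum q n f := by
  simp only [wordSum, List.tail_cons]
  rw [← Finset.sum_mul, hq, one_mul]

open Classical in
theorem wordSum_beginsWithRun (q : Fin 3 → R) (v : Fin 3) (m n : ℕ) (f : List (Fin 3) → R) :
    wordSum q (n + m) (fun r => if BeginsWithRun v m r then f (r.drop m) else 0) =
      q v ^ m * wordSum q n f := by
  induction m with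
  | zero => simp [beginsWithRun_zero]
  | succ m ih =>
    rw [← add_assoc, wordSum, Finset.sum_eq_single v]
    · simp only [beginsWithRun_cons, true_and, List.drop_succ_cons]
      rw [ih, pow_succ']
      ring
    · intro c _ hc
      simp only [beginsWithRun_cons, hc, false_and, if_false]
      rw [wordSum_zero, mul_zero]
    · simp

open Classical in
/-- The weighted sum of `x ^ revCount` over the words whose reversal satisfies
`BeginsWithOnesZeros k₁ 0`. -/
noncomputable def onesZerosSum (q : Fin 3 → R) (x : R) (k₁ k₂ k₃ n : ℕ) : R :=
  wordSum q n fun r => if BeginsWithOnesZeros k₁ 0 r then x ^ revCount k₁ k₂ k₃ r else 0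

open Classical in
theorem wordSum_beginsWithOnesZeros (q : Fin 3 → R) (x : R) (k₁ k₂ k₃ : ℕ) (hk₃ : 0 < k₃)
    (b n : ℕ) :
    wordSum q (n + b) (fun r => if BeginsWithOnesZeros k₁ b r
      then x ^ revCount k₁ k₂ k₃ r else 0) =
      q 1 ^ b * onesZerosSum q x k₁ k₂ k₃ n := by
  rw [onesZerosSum, ← wordSum_beginsWithRun]
  congr 1
  funext r
  have := beginsWithOnesZeros_add (k₁ := k₁) (b := b) (c := 0) (r := r)
  rw [add_zero] at this
  by_cases h : BeginsWithRun 1 b r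
  · simp [this, h, revCount_drop_of_beginsWithRun hk₃ (by decide) h]
  · simp [this, h]

open Classical in
theorem onesZerosSum_succ (q : Fin 3 → R) (x : R) (k₁ k₂ k₃ : ℕ) (hk₃ : 0 < k₃) (n : ℕ) :
    onesZerosSum q x (k₁ + 1) k₂ k₃ (n + (k₁ + 1)) =
      q 1 * onesZerosSum q x (k₁ + 1) k₂ k₃ (n + k₁) +
        q 0 ^ (k₁ + 1) * wordSum q n (fun r => x ^ revCount (k₁ + 1) k₂ k₃ r) := by
  have h1 := wordSum_beginsWithOnesZeros q x (k₁ + 1) k₂ k₃ hk₃ 1 (n + k₁)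
  rw [pow_one] at h1
  rw [← h1, ← wordSum_beginsWithRun, onesZerosSum, add_assoc n k₁ 1, ← wordSum_add]
  congr 1
  funext r
  rw [beginsWithOnesZeros_zero]
  by_cases h : BeginsWithRun 0 (k₁ + 1) r
  · have hn : ¬ BeginsWithOnesZeros (k₁ + 1) 1 r := by
      rintro ⟨a, ha, h1, -⟩
      have e := (h 0 (by omega)).symm.trans (h1 0 (by omega))
      simp at e
    simp [h, hn, revCount_drop_of_beginsWithRun hk₃ (by decide) h]
  · simp [h]

open Classical in
theorem wordSum_completes (q : Fin 3 → R) (x : R) (k₁ k₂ k₃ : ℕ) (hk₂ : 0 < k₂) (hk₃ : 0 < k₃)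
    (n : ℕ) :
    wordSum q (n + k₂ + k₃) (fun r => if Completes k₁ k₂ k₃ r
      then x ^ revCount k₁ k₂ k₃ r.tail else 0) =
      q 2 ^ k₃ * (q 1 ^ k₂ * onesZerosSum q x k₁ k₂ k₃ n) := by
  rw [← wordSum_beginsWithOnesZeros q x k₁ k₂ k₃ hk₃, ← wordSum_beginsWithRun]
  congr 1
  funext r
  by_cases h : Completes k₁ k₂ k₃ r
  · rw [if_pos h, if_pos h.1, if_pos h.2, h.revCount_tail hk₂ hk₃]
  · rw [if_neg h]
    by_cases h' : BeginsWithRun 2 k₃ r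
    · rw [if_pos h', if_neg fun h'' => h ⟨h', h''⟩]
    · rw [if_neg h']

open Classical in
theorem wordSum_revCount_succ (q : Fin 3 → R) (hq : ∑ c, q c = 1) (x : R) (k₁ k₂ k₃ : ℕ)
    (hk₃ : 0 < k₃) (n : ℕ) :
    wordSum q (n + 1) (fun r => x ^ revCount k₁ k₂ k₃ r) =
      wordSum q n (fun r => x ^ revCount k₁ k₂ k₃ r) +
        (x - 1) * wordSum q (n + 1) (fun r => if Completes k₁ k₂ k₃ r
          then x ^ revCount k₁ k₂ k₃ r.tail else 0) := by
  rw [← wordSum_tail q hq n, ← wordSum_mul_left, ← wordSum_add]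
  congr 1
  funext r
  cases r with
  | nil =>
    have : ¬ Completes k₁ k₂ k₃ [] := fun h => by simpa using h.1 0 hk₃
    simp [this]
  | cons c r =>
    rw [revCount, List.tail_cons]
    split_ifs
    · ring
    · simp

theorem wordSum_recurrence (q : Fin 3 → R) (hq : ∑ c, q c = 1) (x : R) (k₁ k₂ k₃ : ℕ)
    (hk₁ : 0 < k₁) (hk₂ : 0 < k₂) (hk₃ : 0 < k₃) (n : ℕ) (hn : k₁ + k₂ + k₃ ≤ n) :
    wordSum q n (fun r => x ^ revCount k₁ k₂ k₃ r) =
      (1 + q 1) * wordSum q (n - 1) (fun r => x ^ revCount k₁ k₂ k₃ r) -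
        q 1 * wordSum q (n - 2) (fun r => x ^ revCount k₁ k₂ k₃ r) +
        (x - 1) * (q 0 ^ k₁ * q 1 ^ k₂ * q 2 ^ k₃) *
          wordSum q (n - (k₁ + k₂ + k₃)) (fun r => x ^ revCount k₁ k₂ k₃ r) := by
  obtain ⟨a, rfl⟩ : ∃ a, k₁ = a + 1 := ⟨k₁ - 1, by omega⟩
  obtain ⟨m, rfl⟩ := Nat.exists_eq_add_of_le' hn
  rw [Nat.add_sub_cancel]
  have e1 := wordSum_revCount_succ q hq x (a + 1) k₂ k₃ hk₃ (m + (a + 1 + k₂ + k₃) - 1)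
  have e2 := wordSum_revCount_succ q hq x (a + 1) k₂ k₃ hk₃ (m + (a + 1 + k₂ + k₃) - 2)
  rw [show m + (a + 1 + k₂ + k₃) - 1 + 1 = m + (a + 1) + k₂ + k₃ by omega,
    wordSum_completes q x _ _ _ hk₂ hk₃, onesZerosSum_succ q x a k₂ k₃ hk₃] at e1
  rw [show m + (a + 1 + k₂ + k₃) - 2 + 1 = m + a + k₂ + k₃ by omega,
    wordSum_completes q x _ _ _ hk₂ hk₃] at e2
  rw [show m + (a + 1 + k₂ + k₃) - 1 = m + a + k₂ + k₃ by omega] at e1 ⊢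
  rw [show m + (a + 1 + k₂ + k₃) = m + (a + 1) + k₂ + k₃ by omega] at *
  linear_combination e1 - q 1 * e2

end WordSum

/-- The pattern occurs at `j`, within the first `n` letters of the infinite sequence `g`. -/
def OccursIn (k₁ k₂ k₃ : ℕ) (g : ℕ → Fin 3) (n j x y : ℕ) : Prop :=
  j + k₁ ≤ x ∧ x + k₂ ≤ y ∧ y + k₃ ≤ n ∧ (∀ t, j ≤ t → t < x → g t = 0) ∧
    (∀ t, x ≤ t → t < y → g t = 1) ∧ (∀ t, y ≤ t → t < y + k₃ → g t = 2) ∧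
    (j = 0 ∨ g (j - 1) ≠ 0)

theorem OccursIn.mono {k₁ k₂ k₃ : ℕ} {g : ℕ → Fin 3} {n n' j x y : ℕ} (hn : n ≤ n')
    (h : OccursIn k₁ k₂ k₃ g n j x y) : OccursIn k₁ k₂ k₃ g n' j x y :=
  ⟨h.1, h.2.1, h.2.2.1.trans hn, h.2.2.2⟩

theorem occursAt_iff {k₁ k₂ k₃ n : ℕ} {s : Fin n → Fin 3} {g : ℕ → Fin 3}
    (hk : 0 < k₁ + k₂ + k₃)
    (hg : ∀ t (ht : t < n), g t = s ⟨t, ht⟩) (j : ℕ) :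
    OccursAt 3 n ![k₁, k₂, k₃] s j ↔ ∃ x y, OccursIn k₁ k₂ k₃ g n j x y := by
  constructor
  · rintro ⟨f, rfl, hn, hf, hs, h0⟩
    have f0 := hf 0
    have f1 := hf 1
    have f2 := hf 2
    simp at f0 f1 f2
    refine ⟨f 1, f 2, f0, f1, by omega, fun t h h' => ?_, fun t h h' => ?_, fun t h h' => ?_, ?_⟩
    · rw [hg t (by omega)]
      exact Fin.ext (hs 0 t (by omega) h h')
    · rw [hg t (by omega)]
      exact Fin.ext (hs 1 t (by omega) h h')
    · rw [hg t (by omega)]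
      exact Fin.ext (hs 2 t (by omega) h (show t < f 3 by omega))
    · refine h0.imp_right ?_
      rintro ⟨h, h'⟩ e
      rw [hg _ h] at e
      exact h' (by rw [e]; rfl)
  · rintro ⟨x, y, h1, h2, h3, g0, g1, g2, h0⟩
    refine ⟨fun i => if i = 0 then j else if i = 1 then x else if i = 2 then y else y + k₃,
      by simp, by simpa using h3, ?_, ?_, ?_⟩
    · intro i
      fin_cases i <;> simp <;> omega
    · intro i t ht
      rw [← hg t ht]
      fin_cases i
      · intro a b
        rw [g0 t (by simpa using a) (by simpa using b)]; rfl
      · intro a b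
        rw [g1 t (by simpa using a) (by simpa using b)]; rfl
      · intro a b
        rw [g2 t (by simpa using a) (by simpa using b)]; rfl
    · refine (Nat.eq_zero_or_pos j).imp_right fun hj => ⟨by omega, ?_⟩
      rw [← hg]
      intro e
      exact (h0.resolve_left hj.ne') (Fin.ext e)

/-- In `g`, some factor `0^k₁ 1^a 2^k₃` with `a ≥ k₂` ends just before position `n`. -/
def FactorEndsAt (k₁ k₂ k₃ : ℕ) (g : ℕ → Fin 3) (n : ℕ) : Prop :=
  ∃ m x y, m + k₁ = x ∧ x + k₂ ≤ y ∧ y + k₃ = n ∧ (∀ t, m ≤ t → t < x → g t = 0) ∧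
    (∀ t, x ≤ t → t < y → g t = 1) ∧ (∀ t, y ≤ t → t < n → g t = 2)

theorem exists_start_of_zeros (g : ℕ → Fin 3) (m x : ℕ)
    (h : ∀ t, m ≤ t → t < x → g t = 0) :
    ∃ j ≤ m, (∀ t, j ≤ t → t < x → g t = 0) ∧ (j = 0 ∨ g (j - 1) ≠ 0) := by
  induction m with
  | zero => exact ⟨0, le_rfl, h, Or.inl rfl⟩
  | succ m ih =>
    by_cases hm : g m = 0
    · obtain ⟨j, hj, hj'⟩ := ih fun t h1 h2 => by
        rcases h1.eq_or_lt with rfl | h1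
        · exact hm
        · exact h t h1 h2
      exact ⟨j, by omega, hj'⟩
    · exact ⟨m + 1, le_rfl, h, Or.inr hm⟩

theorem OccursIn.end_unique {k₁ k₂ k₃ : ℕ} (hk₂ : 0 < k₂) (hk₃ : 0 < k₃) {g : ℕ → Fin 3}
    {n n' j x y x' y' : ℕ} (h : OccursIn k₁ k₂ k₃ g n j x y)
    (h' : OccursIn k₁ k₂ k₃ g n' j x' y') : y = y' := by
  obtain ⟨a1, a2, a3, a4, a5, a6, -⟩ := h
  obtain ⟨b1, b2, b3, b4, b5, b6, -⟩ := h'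
  have hx : x = x' := by
    rcases lt_trichotomy x x' with hlt | heq | hlt
    · have := (a5 x le_rfl (by omega)).symm.trans (b4 x (by omega) hlt)
      simp at this
    · exact heq
    · have := (b5 x' le_rfl (by omega)).symm.trans (a4 x' (by omega) hlt)
      simp at this
  subst hx
  rcases lt_trichotomy y y' with hlt | heq | hlt
  · have := (a6 y le_rfl (by omega)).symm.trans (b5 y (by omega) hlt)
    simp at this
  · exact heq
  · have := (b6 y' le_rfl (by omega)).symm.trans (a5 y' (by omega) hlt)
    simp at this

theorem OccursIn.start_unique {k₁ k₂ k₃ : ℕ} (hk₁ : 0 < k₁) (hk₂ : 0 < k₂) {g : ℕ → Fin 3}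
    {n n' j j' x y x' : ℕ} (h : OccursIn k₁ k₂ k₃ g n j x y)
    (h' : OccursIn k₁ k₂ k₃ g n' j' x' y) : j = j' := by
  obtain ⟨a1, a2, a3, a4, a5, a6, a7⟩ := h
  obtain ⟨b1, b2, b3, b4, b5, b6, b7⟩ := h'
  have hx : x = x' := by
    rcases lt_trichotomy x x' with hlt | heq | hlt
    · have := (a5 (x' - 1) (by omega) (by omega)).symm.trans (b4 (x' - 1) (by omega) (by omega))
      simp at this
    · exact heq
    · have := (b5 (x - 1) (by omega) (by omega)).symm.trans (a4 (x - 1) (by omega) (by omega))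
      simp at this
  subst hx
  rcases lt_trichotomy j j' with hlt | heq | hlt
  · exact absurd (a4 (j' - 1) (by omega) (by omega)) (b7.resolve_left (by omega))
  · exact heq
  · exact absurd (b4 (j - 1) (by omega) (by omega)) (a7.resolve_left (by omega))

open Classical in
theorem ncard_occursIn_succ {k₁ k₂ k₃ : ℕ} (hk₁ : 0 < k₁) (hk₂ : 0 < k₂) (hk₃ : 0 < k₃)
    (g : ℕ → Fin 3) (n : ℕ) :
    {j | ∃ x y, OccursIn k₁ k₂ k₃ g (n + 1) j x y}.ncard =
      {j | ∃ x y, OccursIn k₁ k₂ k₃ g n j x y}.ncard +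
        if FactorEndsAt k₁ k₂ k₃ g (n + 1) then 1 else 0 := by
  have hfin : {j | ∃ x y, OccursIn k₁ k₂ k₃ g n j x y}.Finite := by
    refine (Set.finite_Iic n).subset ?_
    rintro j ⟨x, y, h1, h2, h3, -⟩
    exact Set.mem_Iic.2 (by omega)
  split_ifs with h
  · obtain ⟨m, x, y, hx, hy, hn, h0, h1, h2⟩ := h
    obtain ⟨j, hj, hj0, hj'⟩ := exists_start_of_zeros g m x h0
    have hocc : OccursIn k₁ k₂ k₃ g (n + 1) j x y :=
      ⟨by omega, hy, hn.le, hj0, h1, fun t a b => h2 t a (by omega), hj'⟩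
    rw [← Set.ncard_insert_of_notMem (a := j) _ hfin]
    · congr 1
      ext i
      simp only [Set.mem_ofPred_eq, Set.mem_insert_iff]
      constructor
      · rintro ⟨x', y', hi⟩
        by_cases hle : y' + k₃ ≤ n
        · exact Or.inr ⟨x', y', hi.1, hi.2.1, hle, hi.2.2.2⟩
        · have : y' = y := by
            have := hi.2.2.1
            omega
          subst this
          exact Or.inl (hi.start_unique hk₁ hk₂ hocc)
      · rintro (rfl | ⟨x', y', hi⟩)
        · exact ⟨x, y, hocc⟩
        · exact ⟨x', y', hi.mono n.le_succ⟩
    · rintro ⟨x', y', hi⟩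
      have := hocc.end_unique hk₂ hk₃ hi
      have := hi.2.2.1
      omega
  · rw [Nat.add_zero]
    congr 1
    ext i
    constructor
    · rintro ⟨x', y', a1, a2, a3, a4, a5, a6, a7⟩
      refine ⟨x', y', a1, a2, ?_, a4, a5, a6, a7⟩
      by_contra hlt
      exact h ⟨x' - k₁, x', y', by omega, a2, by omega, fun t ht => a4 t (by omega), a5,
        fun t ht ht' => a6 t ht (by omega)⟩
    · rintro ⟨x', y', hi⟩
      exact ⟨x', y', hi.mono n.le_succ⟩

theorem completes_iff_factorEndsAt {k₁ k₂ k₃ : ℕ} (hk₁ : 0 < k₁) {g : ℕ → Fin 3}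
    {r : List (Fin 3)} (hg : ∀ t < r.length, r[t]? = some (g (r.length - 1 - t))) :
    Completes k₁ k₂ k₃ r ↔ FactorEndsAt k₁ k₂ k₃ g r.length := by
  have key : ∀ t v, r[t]? = some v ↔ t < r.length ∧ g (r.length - 1 - t) = v := by
    intro t v
    constructor
    · intro h
      obtain ⟨ht, -⟩ := List.getElem?_eq_some_iff.1 h
      rw [hg t ht] at h
      exact ⟨ht, Option.some.inj h⟩
    · rintro ⟨ht, h⟩
      rw [hg t ht, h]
  constructor
  · rintro ⟨h2, a, ha, h1, h0⟩
    simp only [BeginsWithRun, List.getElem?_drop, key] at h2 h1 h0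
    have hlen := (h0 (k₁ - 1) (by omega)).1
    refine ⟨r.length - k₃ - a - k₁, r.length - k₃ - a, r.length - k₃, by omega, by omega,
      by omega, fun t ht ht' => ?_, fun t ht ht' => ?_, fun t ht ht' => ?_⟩
    · have := (h0 (r.length - 1 - t - k₃ - a) (by omega)).2
      rwa [show r.length - 1 - (k₃ + (a + (r.length - 1 - t - k₃ - a))) = t by omega] at this
    · have := (h1 (r.length - 1 - t - k₃) (by omega)).2
      rwa [show r.length - 1 - (k₃ + (r.length - 1 - t - k₃)) = t by omega] at this
    · have := (h2 (r.length - 1 - t) (by omega)).2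
      rwa [show r.length - 1 - (r.length - 1 - t) = t by omega] at this
  · rintro ⟨m, x, y, hx, hy, hn, h0, h1, h2⟩
    refine ⟨?_, y - x, by omega, ?_, ?_⟩ <;> intro t ht <;>
      simp only [List.getElem?_drop, key]
    · exact ⟨by omega, h2 _ (by omega) (by omega)⟩
    · exact ⟨by omega, h1 _ (by omega) (by omega)⟩
    · exact ⟨by omega, h0 _ (by omega) (by omega)⟩

theorem reverse_ofFn_succ {α : Type*} {n : ℕ} (s : Fin (n + 1) → α) :
    (List.ofFn s).reverse = s (Fin.last n) :: (List.ofFn fun i => s (Fin.castSucc i)).reverse := by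
  rw [List.ofFn_succ', List.concat_eq_append, List.reverse_append]
  rfl

theorem patCount_eq_revCount {k₁ k₂ k₃ : ℕ} (hk₁ : 0 < k₁) (hk₂ : 0 < k₂) (hk₃ : 0 < k₃)
    {n : ℕ} (s : Fin n → Fin 3) :
    patCount 3 n ![k₁, k₂, k₃] s = revCount k₁ k₂ k₃ (List.ofFn s).reverse := by
  let g : ℕ → Fin 3 := fun t => if ht : t < n then s ⟨t, ht⟩ else 0
  have hg : ∀ t (ht : t < n), g t = s ⟨t, ht⟩ := fun t ht => dif_pos ht
  clear_value g
  simp only [patCount, occursAt_iff (by omega : 0 < k₁ + k₂ + k₃) hg]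
  induction n with
  | zero =>
    rw [List.ofFn_zero, List.reverse_nil, revCount]
    convert Set.ncard_empty ℕ
    ext j
    simp only [Set.mem_ofPred_eq, Set.mem_empty_iff_false, iff_false]
    rintro ⟨x, y, h1, h2, h3, -⟩
    omega
  | succ n ih =>
    have hr := reverse_ofFn_succ s
    have hc := completes_iff_factorEndsAt (k₂ := k₂) (k₃ := k₃) hk₁ (g := g)
      (r := (List.ofFn s).reverse) fun t ht => by
        simp only [List.length_reverse, List.length_ofFn] at ht ⊢
        rw [List.getElem?_reverse (by simpa using ht), List.getElem?_ofFn, List.length_ofFn,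
          dif_pos (by omega), hg]
    rw [List.length_reverse, List.length_ofFn] at hc
    rw [ncard_occursIn_succ hk₁ hk₂ hk₃, ih (fun i => s (Fin.castSucc i))
      (fun t ht => hg t (by omega)), hr, revCount, ← hr]
    by_cases h : FactorEndsAt k₁ k₂ k₃ g (n + 1)
    · rw [if_pos h, if_pos (hc.2 h)]
    · rw [if_neg h, if_neg (mt hc.1 h)]

theorem sum_eq_wordSum {R : Type*} [CommRing R] (q : Fin 3 → R) (n : ℕ)
    (f : List (Fin 3) → R) :
    ∑ s : Fin n → Fin 3, (∏ t, q (s t)) * f (List.ofFn s).reverse = wordSum q n f := by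
  induction n generalizing f with
  | zero => simp [wordSum]
  | succ n ih =>
    rw [wordSum, ← (Fin.snocEquiv fun _ => Fin 3).sum_comp, Fintype.sum_prod_type]
    refine Finset.sum_congr rfl fun c _ => ?_
    rw [← ih, Finset.mul_sum]
    refine Finset.sum_congr rfl fun s _ => ?_
    rw [reverse_ofFn_succ, Fin.prod_univ_castSucc]
    simp only [Fin.snocEquiv, Equiv.coe_fn_mk, Fin.snoc_castSucc, Fin.snoc_last]
    ring

theorem Fpoly_eq_wordSum {k₁ k₂ k₃ : ℕ} (hk₁ : 0 < k₁) (hk₂ : 0 < k₂) (hk₃ : 0 < k₃)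
    (p : Fin 3 → ℝ) (n : ℕ) :
    Fpoly 3 n ![k₁, k₂, k₃] p =
      wordSum (fun c => Polynomial.C (p c)) n
        (fun r => Polynomial.X ^ revCount k₁ k₂ k₃ r) := by
  rw [← sum_eq_wordSum, Fpoly]
  simp only [patCount_eq_revCount hk₁ hk₂ hk₃, wt, map_prod]

theorem statement11 (k₁ k₂ k₃ : ℕ) (hk₁ : 0 < k₁) (hk₂ : 0 < k₂) (hk₃ : 0 < k₃)
    (p₁ p₂ p₃ : ℝ) (hp₁ : 0 ≤ p₁) (hp₂ : 0 ≤ p₂) (hp₃ : 0 ≤ p₃)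
    (hsum : p₁ + p₂ + p₃ = 1)
    (n : ℕ) (hn : k₁ + k₂ + k₃ ≤ n) :
    Fpoly 3 n ![k₁, k₂, k₃] ![p₁, p₂, p₃] =
      Polynomial.C (1 + p₂) * Fpoly 3 (n - 1) ![k₁, k₂, k₃] ![p₁, p₂, p₃] -
        Polynomial.C p₂ * Fpoly 3 (n - 2) ![k₁, k₂, k₃] ![p₁, p₂, p₃] +
        (Polynomial.X - 1) * Polynomial.C (p₁ ^ k₁ * p₂ ^ k₂ * p₃ ^ k₃) *
          Fpoly 3 (n - (k₁ + k₂ + k₃)) ![k₁, k₂, k₃] ![p₁, p₂, p₃] := by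
  simp only [Fpoly_eq_wordSum hk₁ hk₂ hk₃]
  rw [wordSum_recurrence _ _ _ k₁ k₂ k₃ hk₁ hk₂ hk₃ n hn]
  · simp
  · rw [← map_sum, Fin.sum_univ_three]
    simp [hsum]
end

section
/- Let ℓ ≥ 2 be an integer, k_1,…,k_ℓ positive integers with k = k_1+⋯+k_ℓ, and p_1,…,p_ℓ ≥ 0 reals with p_1+⋯+p_ℓ = 1 and p_i < 1 for i = 2,…,ℓ−1. Let E_n = Σ_s weight(s)·X(s), the sum over all sequences s of length n over {1,…,ℓ}. Then there exists a constant C ≥ 0 such that for all n ≥ k, | E_n − (∏_{i=1}^{ℓ} p_i^{k_i}) (n − k + 1) / ∏_{i=2}^{ℓ−1} (1 − p_i) | ≤ C (empty products equal 1); i.e., E_n equals (∏_{i=1}^{ℓ} p_i^{k_i})(n−k+1)/∏_{i=2}^{ℓ−1}(1−p_i) up to a bounded error as n → ∞. -/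
/-- The starting position of the `m`-th block when consecutive blocks of lengths `L 0, L 1, …`
are placed from position `a` on. -/
def blockStart {ℓ : ℕ} (a : ℕ) (L : Fin ℓ → ℕ) (m : ℕ) : ℕ :=
  a + ∑ i : Fin ℓ, if (i : ℕ) < m then L i else 0

/-- The letter `x` is compatible at position `t` with an occurrence starting at `a` whose
blocks have lengths `L`. -/
def Compatible {ℓ : ℕ} (a : ℕ) (L : Fin ℓ → ℕ) (t : ℕ) (x : Fin ℓ) : Prop :=
  (∀ i : Fin ℓ, blockStart a L i ≤ t → t < blockStart a L (i + 1) → x = i) ∧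
    (t + 1 = a → (x : ℕ) ≠ 0)

section BlockStart

variable {ℓ : ℕ} (a : ℕ) (L : Fin ℓ → ℕ)

theorem blockStart_zero : blockStart a L 0 = a := by simp [blockStart]

theorem blockStart_succ (i : Fin ℓ) :
    blockStart a L (i + 1) = blockStart a L i + L i := by
  unfold blockStart
  rw [add_assoc, ← Finset.sum_ite_eq' Finset.univ i L |>.trans (if_pos (Finset.mem_univ i)),
    ← Finset.sum_add_distrib]
  congr 1
  refine Finset.sum_congr rfl fun x _ => ?_
  have : x = i ↔ (x : ℕ) = i := Fin.ext_iff
  split_ifs <;> omega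

theorem blockStart_length : blockStart a L ℓ = a + ∑ i, L i := by simp [blockStart]

theorem blockStart_mono : Monotone (blockStart a L) := by
  intro m m' h
  unfold blockStart
  gcongr with i
  split_ifs <;> omega

theorem le_blockStart (m : ℕ) : a ≤ blockStart a L m := by simp [blockStart]

theorem compatible_iff_of_mem_block {t : ℕ} {i x : Fin ℓ} (h₁ : blockStart a L i ≤ t)
    (h₂ : t < blockStart a L (i + 1)) : Compatible a L t x ↔ x = i := by
  refine ⟨fun h => h.1 i h₁ h₂, ?_⟩
  rintro rfl
  refine ⟨fun y h₃ h₄ => ?_, fun h => ?_⟩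
  · by_contra hne
    have hne' : (x : ℕ) ≠ y := fun h => hne (Fin.ext h)
    rcases lt_or_gt_of_ne hne' with h | h
    · have := blockStart_mono a L (show (x : ℕ) + 1 ≤ y by omega)
      omega
    · have := blockStart_mono a L (show (y : ℕ) + 1 ≤ x by omega)
      omega
  · have := le_blockStart a L x
    omega

theorem compatible_iff_of_lt {t : ℕ} {x : Fin ℓ} (h : t < a) :
    Compatible a L t x ↔ (t + 1 = a → (x : ℕ) ≠ 0) := by
  refine ⟨fun h => h.2, fun h' => ⟨fun i hi _ => ?_, h'⟩⟩
  have := le_blockStart a L i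
  omega

theorem compatible_of_le {t : ℕ} {x : Fin ℓ} (h : blockStart a L ℓ ≤ t) :
    Compatible a L t x := by
  refine ⟨fun i _ hi => ?_, fun h' => ?_⟩
  · have := blockStart_mono a L (show (i : ℕ) + 1 ≤ ℓ from i.2)
    omega
  · have := le_blockStart a L ℓ
    omega

open Classical in
theorem prod_Ico_blockStart (p : Fin ℓ → ℝ) {m : ℕ} (hm : m ≤ ℓ) :
    ∏ t ∈ Finset.Ico a (blockStart a L m), ∑ x with Compatible a L t x, p x =
      ∏ i : Fin ℓ, if (i : ℕ) < m then p i ^ L i else 1 := by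
  induction m with
  | zero => simp [blockStart_zero]
  | succ m ih =>
    let i : Fin ℓ := ⟨m, hm⟩
    have hs : blockStart a L (m + 1) = blockStart a L m + L i := blockStart_succ a L i
    rw [← Finset.prod_Ico_consecutive _ (le_blockStart a L m)
      (blockStart_mono a L (Nat.le_succ m)), ih (by omega)]
    have h : ∀ t ∈ Finset.Ico (blockStart a L m) (blockStart a L (m + 1)),
        ∑ x with Compatible a L t x, p x = p i := by
      intro t ht
      rw [Finset.mem_Ico] at ht
      simp [Finset.sum_filter, compatible_iff_of_mem_block a L (i := i) ht.1 ht.2]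
    rw [Finset.prod_congr rfl h, Finset.prod_const, Nat.card_Ico, hs, Nat.add_sub_cancel_left,
      ← Finset.prod_ite_eq' Finset.univ i (fun i => p i ^ L i) |>.trans
        (if_pos (Finset.mem_univ i)), ← Finset.prod_mul_distrib]
    refine Finset.prod_congr rfl fun x _ => ?_
    have : x = i ↔ (x : ℕ) = m := Fin.ext_iff
    split_ifs <;> first | omega | simp

open Classical in
/-- The total weight of the sequences compatible with given block lengths and start. -/
theorem sum_wt_compatible {n : ℕ} (p : Fin ℓ → ℝ) (hsum : ∑ i, p i = 1) (z : Fin ℓ)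
    (hz : (z : ℕ) = 0) (h : blockStart a L ℓ ≤ n) :
    ∑ s : Fin n → Fin ℓ with ∀ t : Fin n, Compatible a L t (s t), wt ℓ n p s =
      (if a = 0 then 1 else 1 - p z) * ∏ i, p i ^ L i := by
  have hpi : ({s : Fin n → Fin ℓ | ∀ t : Fin n, Compatible a L t (s t)} : Finset _) =
      Fintype.piFinset fun t : Fin n => ({x | Compatible a L t x} : Finset (Fin ℓ)) := by
    ext s; simp
  unfold wt
  rw [hpi, ← Finset.prod_univ_sum,
    Fin.prod_univ_eq_prod_range (fun t => ∑ x with Compatible a L t x, p x) n,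
    Finset.range_eq_Ico, ← Finset.prod_Ico_consecutive _ (Nat.zero_le a)
      ((le_blockStart a L ℓ).trans h),
    ← Finset.prod_Ico_consecutive _ (le_blockStart a L ℓ) h, prod_Ico_blockStart a L p le_rfl]
  have htail : ∏ t ∈ Finset.Ico (blockStart a L ℓ) n, ∑ x with Compatible a L t x, p x = 1 := by
    refine Finset.prod_eq_one fun t ht => ?_
    rw [Finset.mem_Ico] at ht
    simp [compatible_of_le a L ht.1, hsum]
  rw [htail, mul_one]
  simp only [Fin.is_lt, if_true]
  congr 1
  rcases a with _ | a
  · simp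
  · rw [if_neg (by omega), Finset.prod_Ico_succ_top (Nat.zero_le a), Finset.prod_eq_one, one_mul]
    · simp_rw [compatible_iff_of_lt (a + 1) L (Nat.lt_succ_self a)]
      have : ({x : Fin ℓ | True → (x : ℕ) ≠ 0} : Finset _) = Finset.univ.erase z := by
        ext x; simp [Fin.ext_iff, hz]
      rw [this, ← hsum, ← Finset.add_sum_erase Finset.univ p (Finset.mem_univ z)]
      ring
    · intro t ht
      rw [Finset.mem_Ico] at ht
      have hne : t + 1 ≠ a + 1 := by omega
      simp [compatible_iff_of_lt (a + 1) L (show t < a + 1 by omega), ht.2.ne, hsum]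

end BlockStart

section Occurrences

variable {ℓ n : ℕ} {k : Fin ℓ → ℕ}

theorem occursAt_of_compatible {s : Fin n → Fin ℓ} {a : ℕ} {b : Fin ℓ → ℕ}
    (hle : blockStart a (k + b) ℓ ≤ n) (h : ∀ t : Fin n, Compatible a (k + b) t (s t)) :
    OccursAt ℓ n k s a := by
  refine ⟨blockStart a (k + b), blockStart_zero _ _, hle, fun i => ?_, fun i t ht h₁ h₂ => ?_, ?_⟩
  · simp [blockStart_succ, ← add_assoc]
  · rw [(h ⟨t, ht⟩).1 i h₁ h₂]
  · have := le_blockStart a (k + b) ℓ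
    rcases Nat.eq_zero_or_pos a with h0 | h0
    · exact Or.inl h0
    · exact Or.inr ⟨by omega, (h ⟨a - 1, by omega⟩).2 (Nat.sub_add_cancel h0)⟩

theorem exists_compatible_of_occursAt {s : Fin n → Fin ℓ} {a : ℕ} (h : OccursAt ℓ n k s a)
    (hℓ : 0 < ℓ) :
    ∃ b : Fin ℓ → ℕ, (∀ i : Fin ℓ, (i : ℕ) = ℓ - 1 → b i = 0) ∧
      blockStart a (k + b) ℓ ≤ n ∧ ∀ t : Fin n, Compatible a (k + b) t (s t) := by
  obtain ⟨j, rfl, hn, hk, hs, hprev⟩ := h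
  let b : Fin ℓ → ℕ := fun i => if (i : ℕ) = ℓ - 1 then 0 else j (i + 1) - j i - k i
  have hpos : ∀ m, m < ℓ → blockStart (j 0) (k + b) m = j m := by
    intro m
    induction m with
    | zero => intro _; exact blockStart_zero _ _
    | succ m ih =>
      intro hm
      have h₁ := blockStart_succ (j 0) (k + b) ⟨m, by omega⟩
      have h₂ := hk ⟨m, by omega⟩
      have h₃ := ih (by omega)
      have h₄ : b ⟨m, by omega⟩ = j (m + 1) - j m - k ⟨m, by omega⟩ :=
        if_neg (show ¬ m = ℓ - 1 by omega)
      simp only [Pi.add_apply] at h₁ h₂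
      omega
  have hpos_le : ∀ m, m ≤ ℓ → blockStart (j 0) (k + b) m ≤ j m := by
    intro m hm
    rcases hm.lt_or_eq with hm | rfl
    · exact (hpos m hm).le
    · have h₁ := blockStart_succ (j 0) (k + b) ⟨m - 1, by omega⟩
      have h₂ := hk ⟨m - 1, by omega⟩
      have h₃ := hpos (m - 1) (by omega)
      have h₄ : b ⟨m - 1, by omega⟩ = 0 := if_pos rfl
      simp only [Pi.add_apply, Nat.sub_add_cancel hℓ] at h₁ h₂
      omega
  refine ⟨b, fun i hi => if_pos hi, (hpos_le ℓ le_rfl).trans hn, fun t => ⟨fun i h₁ h₂ => ?_, ?_⟩⟩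
  · rw [hpos i i.2] at h₁
    exact Fin.ext (hs i t t.2 h₁ (h₂.trans_le (hpos_le _ i.2)))
  · intro ht
    rcases hprev with h0 | ⟨h1, h2⟩
    · omega
    · convert h2
      omega

theorem compatible_unique {s : Fin n → Fin ℓ} {a : ℕ} {L L' : Fin ℓ → ℕ} (hL : ∀ i, 0 < L i)
    (hL' : ∀ i, 0 < L' i) (hlast : ∀ i : Fin ℓ, (i : ℕ) = ℓ - 1 → L i = L' i)
    (hn : blockStart a L ℓ ≤ n) (hn' : blockStart a L' ℓ ≤ n)
    (h : ∀ t : Fin n, Compatible a L t (s t)) (h' : ∀ t : Fin n, Compatible a L' t (s t)) : L = L' := by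
  have key : ∀ {L L' : Fin ℓ → ℕ}, (∀ i, 0 < L i) → blockStart a L ℓ ≤ n →
      (∀ t : Fin n, Compatible a L t (s t)) → (∀ t : Fin n, Compatible a L' t (s t)) →
      ∀ m, m + 1 < ℓ → blockStart a L m = blockStart a L' m →
        blockStart a L' (m + 1) ≤ blockStart a L (m + 1) := by
    intro L L' hL hn h h' m hm heq
    by_contra! hlt
    have h₁ := blockStart_succ a L ⟨m + 1, hm⟩
    have h₂ := hL ⟨m + 1, hm⟩
    have h₃ := blockStart_mono a L (show m + 1 + 1 ≤ ℓ by omega)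
    have h₄ := blockStart_mono a L (show m ≤ m + 1 by omega)
    simp only at h₁
    have e₁ := (h ⟨blockStart a L (m + 1), by omega⟩).1 ⟨m + 1, hm⟩ le_rfl
      (by dsimp only; omega)
    have e₂ := (h' ⟨blockStart a L (m + 1), by omega⟩).1 ⟨m, by omega⟩
      (by simp only; omega) hlt
    have := congrArg Fin.val (e₁.symm.trans e₂)
    simp at this
  have hpos : ∀ m, m < ℓ → blockStart a L m = blockStart a L' m := by
    intro m
    induction m with
    | zero => simp [blockStart_zero]
    | succ m ih =>
      intro hm
      have e := ih (by omega)
      exact le_antisymm (key hL' hn' h' h m hm e.symm) (key hL hn h h' m hm e)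
  ext i
  by_cases hi : (i : ℕ) = ℓ - 1
  · exact hlast i hi
  · have h₁ := blockStart_succ a L i
    have h₂ := blockStart_succ a L' i
    have h₃ := hpos i i.2
    have h₄ := hpos (i + 1) (by omega)
    omega

/-- The possible excess block lengths of occurrences in sequences of length `n`, the last block
being taken as short as possible. -/
def excess (ℓ n : ℕ) : Finset (Fin ℓ → ℕ) :=
  Fintype.piFinset fun i => if (i : ℕ) = ℓ - 1 then {0} else Finset.range (n + 1)

theorem mem_excess {b : Fin ℓ → ℕ} :
    b ∈ excess ℓ n ↔ ∀ i : Fin ℓ, if (i : ℕ) = ℓ - 1 then b i = 0 else b i ≤ n := by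
  simp only [excess, Fintype.mem_piFinset]
  refine forall_congr' fun i => ?_
  split_ifs <;> simp

open Classical in
theorem patCount_eq_card (hℓ : 0 < ℓ) (hk : ∀ i, 0 < k i) (s : Fin n → Fin ℓ) :
    patCount ℓ n k s = (((Finset.range (n + 1)) ×ˢ excess ℓ n).filter fun x =>
      blockStart x.1 (k + x.2) ℓ ≤ n ∧ ∀ t : Fin n, Compatible x.1 (k + x.2) t (s t)).card := by
  rw [patCount, ← Finset.card_image_of_injOn (f := Prod.fst), ← Set.ncard_coe_finset]
  · congr 1
    ext a
    simp only [Set.mem_ofPred_eq, Finset.coe_image, Set.mem_image, Finset.mem_coe,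
      Finset.mem_filter, Finset.mem_product, Prod.exists, exists_and_right, exists_eq_right]
    constructor
    · intro h
      obtain ⟨b, hb, hn, hc⟩ := exists_compatible_of_occursAt h hℓ
      have hlen := hn
      rw [blockStart_length] at hlen
      refine ⟨b, ⟨Finset.mem_range.2 (by omega), mem_excess.2 fun i => ?_⟩, hn, hc⟩
      split_ifs with hi
      · exact hb i hi
      · have : (k + b) i ≤ ∑ i, (k + b) i :=
          Finset.single_le_sum (fun _ _ => Nat.zero_le _) (Finset.mem_univ i)
        simp only [Pi.add_apply] at this hlen
        omega
    · rintro ⟨b, -, hn, hc⟩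
      exact occursAt_of_compatible hn hc
  · rintro ⟨a, b⟩ h ⟨a', b'⟩ h' (rfl : a = a')
    simp only [Finset.coe_filter, Finset.mem_product, Set.mem_ofPred_eq] at h h'
    have hpos : ∀ (b : Fin ℓ → ℕ) i, 0 < (k + b) i := fun b i => Nat.add_pos_left (hk i) _
    have := compatible_unique (hpos b) (hpos b') (fun i hi => ?_) h.2.1 h'.2.1 h.2.2 h'.2.2
    · rw [add_left_cancel this]
    · have h₁ := mem_excess.1 h.1.2 i
      have h₂ := mem_excess.1 h'.1.2 i
      rw [if_pos hi] at h₁ h₂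
      simp [h₁, h₂]

end Occurrences

/-- The sum over the starting positions of an occurrence whose blocks have total length `c`. -/
theorem sum_range_start_weight (r : ℝ) (n c : ℕ) :
    (∑ a ∈ Finset.range (n + 1), if a + c ≤ n then (if a = 0 then 1 else r) else 0) =
      if c ≤ n then 1 + r * ((n : ℝ) - c) else 0 := by
  split_ifs with h
  · rw [← Finset.sum_filter]
    have : (Finset.range (n + 1)).filter (fun a => a + c ≤ n) = Finset.range (n - c + 1) := by
      ext a; simp only [Finset.mem_filter, Finset.mem_range]; omega
    rw [this, Finset.sum_range_succ', if_pos rfl]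
    simp [Nat.cast_sub h]
    ring
  · refine Finset.sum_eq_zero fun a _ => if_neg (by omega)

theorem ewt_eq_sum {ℓ n : ℕ} {k : Fin ℓ → ℕ} {p : Fin ℓ → ℝ} (hk : ∀ i, 0 < k i)
    (hsum : ∑ i, p i = 1) (z : Fin ℓ) (hz : (z : ℕ) = 0) :
    Ewt ℓ n k p = (∏ i, p i ^ k i) * ∑ b ∈ excess ℓ n, (∏ i, p i ^ b i) *
      if (∑ i, k i) + ∑ i, b i ≤ n then
        1 + (1 - p z) * ((n : ℝ) - ((∑ i, k i) + ∑ i, b i : ℕ)) else 0 := by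
  classical
  have hℓ : 0 < ℓ := z.pos
  simp_rw [Ewt, patCount_eq_card hℓ hk, Finset.card_filter, Nat.cast_sum, Finset.mul_sum]
  rw [Finset.sum_comm, Finset.sum_product_right]
  refine Finset.sum_congr rfl fun b _ => ?_
  rw [← sum_range_start_weight, Finset.mul_sum, Finset.mul_sum]
  refine Finset.sum_congr rfl fun a _ => ?_
  have hlen : blockStart a (k + b) ℓ = a + (∑ i, k i + ∑ i, b i) := by
    simp [blockStart_length, Finset.sum_add_distrib]
  split_ifs with h h0 <;> rw [← hlen] at h
  · have := sum_wt_compatible a (k + b) p hsum z hz h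
    rw [if_pos h0, Finset.sum_filter] at this
    simpa [h, pow_add, Finset.prod_mul_distrib] using this
  · have := sum_wt_compatible a (k + b) p hsum z hz h
    rw [if_neg h0, Finset.sum_filter] at this
    simp only [h, true_and, Nat.cast_ite, Nat.cast_one, Nat.cast_zero, mul_ite, mul_one, mul_zero,
      this, Pi.add_apply, pow_add, Finset.prod_mul_distrib]
    ring
  · simp [h]

theorem hasSum_pi_prod {m : ℕ} {f : Fin m → ℕ → ℝ} {a : Fin m → ℝ} (hf : ∀ i x, 0 ≤ f i x)
    (h : ∀ i, HasSum (f i) (a i)) :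
    HasSum (fun b : Fin m → ℕ => ∏ i, f i (b i)) (∏ i, a i) := by
  induction m with
  | zero => simp
  | succ m ih =>
    have ih' := ih (fun i => hf i.succ) (fun i => h i.succ)
    have hprod : ∀ b : Fin m → ℕ, 0 ≤ ∏ i, f (Fin.succ i) (b i) :=
      fun b => Finset.prod_nonneg fun i _ => hf _ _
    have hmul := (h 0).summable.mul_of_nonneg ih'.summable (hf 0) hprod
    have := (h 0).mul ih' hmul
    rw [Fin.prod_univ_succ]
    refine (Fin.consEquiv fun _ : Fin (m + 1) => ℕ).hasSum_iff.1 (this.congr_fun ?_)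
    simp [Fin.consEquiv, Fin.prod_univ_succ]

theorem one_add_sum_le_prod_one_add {ι : Type*} (t : Finset ι) (b : ι → ℕ) :
    1 + ∑ i ∈ t, b i ≤ ∏ i ∈ t, (1 + b i) := by
  classical
  induction t using Finset.induction_on with
  | empty => simp
  | insert i t hi ih =>
    rw [Finset.sum_insert hi, Finset.prod_insert hi]
    nlinarith [Nat.zero_le (b i * ∑ i ∈ t, b i)]

theorem abs_start_weight_sub_le {r : ℝ} (h0 : 0 ≤ r) (h1 : r ≤ 1) {n K : ℕ} (hn : K ≤ n)
    (m : ℕ) :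
    |(if K + m ≤ n then 1 + r * ((n : ℝ) - (K + m : ℕ)) else 0) - r * ((n : ℝ) - K + 1)| ≤
      1 + m := by
  have hm : (0 : ℝ) ≤ m := m.cast_nonneg
  have hn' : (K : ℝ) ≤ n := by exact_mod_cast hn
  split_ifs with h
  · rw [abs_le]
    push_cast
    constructor <;> nlinarith
  · have h' : (n : ℝ) + 1 ≤ K + m := by exact_mod_cast (show n + 1 ≤ K + m by omega)
    rw [zero_sub, abs_neg, abs_of_nonneg (by nlinarith)]
    nlinarith

theorem statement14 (ℓ : ℕ) (hℓ : 2 ≤ ℓ) (k : Fin ℓ → ℕ) (hk : ∀ i, 0 < k i)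
    (p : Fin ℓ → ℝ) (hp : ∀ i, 0 ≤ p i) (hsum : ∑ i, p i = 1)
    (hplt : ∀ i : Fin ℓ, 0 < (i : ℕ) → (i : ℕ) < ℓ - 1 → p i < 1) :
    ∃ C : ℝ, 0 ≤ C ∧ ∀ n, (∑ i, k i) ≤ n →
      |Ewt ℓ n k p -
          (∏ i, p i ^ k i) * ((n : ℝ) - ((∑ i, k i : ℕ) : ℝ) + 1) /
            ∏ i ∈ Finset.univ.filter (fun i : Fin ℓ => 0 < (i : ℕ) ∧ (i : ℕ) < ℓ - 1),
              (1 - p i)| ≤ C := by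
  let z : Fin ℓ := ⟨0, by omega⟩
  let e : Fin ℓ := ⟨ℓ - 1, by omega⟩
  have hze : e ≠ z := by simp only [ne_eq, Fin.ext_iff, e, z]; omega
  have hpz : p z ≤ 1 := hsum ▸ Finset.single_le_sum (fun i _ => hp i) (Finset.mem_univ z)
  have hP : 0 ≤ ∏ i, p i ^ k i := Finset.prod_nonneg fun i _ => pow_nonneg (hp i) _
  rcases hpz.lt_or_eq with hpz1 | hpz1
  swap
  · have he : p e = 0 := by
      have h := Finset.add_sum_erase Finset.univ p (Finset.mem_univ z)
      have h' := Finset.single_le_sum (f := p) (s := Finset.univ.erase z) (fun i _ => hp i)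
        (Finset.mem_erase.2 ⟨hze, Finset.mem_univ e⟩)
      linarith [hp e]
    have hP0 : ∏ i, p i ^ k i = 0 :=
      Finset.prod_eq_zero (Finset.mem_univ e) (by rw [he, zero_pow (hk e).ne'])
    exact ⟨0, le_rfl, fun n _ => by simp [ewt_eq_sum hk hsum z rfl, hP0]⟩
  let q : Fin ℓ → ℝ := fun i => if (i : ℕ) = ℓ - 1 then 0 else p i
  have hq0 : ∀ i, 0 ≤ q i := fun i => by dsimp only [q]; split_ifs; exacts [le_rfl, hp i]
  have hq1 : ∀ i, q i < 1 := fun i => by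
    dsimp only [q]
    split_ifs with h
    · exact one_pos
    · rcases Nat.eq_zero_or_pos i with h0 | h0
      · rwa [show i = z from Fin.ext h0]
      · exact hplt i h0 (by omega)
  have hgeom := hasSum_pi_prod (f := fun i x => q i ^ x) (fun i x => pow_nonneg (hq0 i) x)
    fun i => hasSum_geometric_of_lt_one (hq0 i) (hq1 i)
  have hdom : Summable fun b : Fin ℓ → ℕ => ∏ i, (1 + (b i : ℝ)) * q i ^ b i := by
    refine (hasSum_pi_prod (f := fun i x => (1 + (x : ℝ)) * q i ^ x)
      (fun i x => mul_nonneg (by positivity) (pow_nonneg (hq0 i) x)) fun i =>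
        Summable.hasSum ?_).summable
    have h₁ := summable_geometric_of_lt_one (hq0 i) (hq1 i)
    have h₂ := summable_pow_mul_geometric_of_norm_lt_one (R := ℝ) 1 (r := q i)
      (by rw [Real.norm_of_nonneg (hq0 i)]; exact hq1 i)
    simpa [add_mul] using h₁.add h₂
  have hmid : (∏ i, (1 - q i)⁻¹) * (1 - p z) =
      (∏ i ∈ Finset.univ.filter (fun i : Fin ℓ => 0 < (i : ℕ) ∧ (i : ℕ) < ℓ - 1),
        (1 - p i))⁻¹ := by
    have hne : 1 - p z ≠ 0 := by linarith
    have hqz : q z = p z := if_neg (show ¬ 0 = ℓ - 1 by omega)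
    rw [← Finset.mul_prod_erase _ _ (Finset.mem_univ z), hqz, mul_right_comm,
      inv_mul_cancel₀ hne, one_mul, ← Finset.prod_inv_distrib]
    symm
    refine Finset.prod_subset_one_on_sdiff ?_ ?_ ?_
    · intro i hi
      simp only [Finset.mem_filter, Finset.mem_univ, true_and] at hi
      simp only [Finset.mem_erase, Finset.mem_univ, and_true, ne_eq, Fin.ext_iff, z]
      omega
    · intro i hi
      simp only [Finset.mem_sdiff, Finset.mem_filter, Finset.mem_erase, Finset.mem_univ,
        and_true, true_and, ne_eq, Fin.ext_iff, z] at hi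
      have : q i = 0 := if_pos (by omega)
      simp [this]
    · intro i hi
      simp only [Finset.mem_filter, Finset.mem_univ, true_and] at hi
      have : q i = p i := if_neg (by omega)
      rw [this]
  refine ⟨(∏ i, p i ^ k i) * ∑' b : Fin ℓ → ℕ, ∏ i, (1 + (b i : ℝ)) * q i ^ b i,
    mul_nonneg hP (tsum_nonneg fun b => Finset.prod_nonneg fun i _ =>
      mul_nonneg (by positivity) (pow_nonneg (hq0 i) _)), fun n hn => ?_⟩
  let φ : (Fin ℓ → ℕ) → ℝ := fun b => if (∑ i, k i) + ∑ i, b i ≤ n then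
    1 + (1 - p z) * ((n : ℝ) - ((∑ i, k i) + ∑ i, b i : ℕ)) else 0
  have hfin : HasSum (fun b => (∏ i, q i ^ b i) * φ b)
      (∑ b ∈ excess ℓ n, (∏ i, p i ^ b i) * φ b) := by
    have : ∑ b ∈ excess ℓ n, (∏ i, p i ^ b i) * φ b =
        ∑ b ∈ excess ℓ n, (∏ i, q i ^ b i) * φ b := by
      refine Finset.sum_congr rfl fun b hb => ?_
      congr 1
      refine Finset.prod_congr rfl fun i _ => ?_
      have := mem_excess.1 hb i
      dsimp only [q]
      split_ifs at this ⊢ <;> simp [*]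
    rw [this]
    refine hasSum_sum_of_ne_finset_zero fun b hb => ?_
    rw [mem_excess] at hb
    push Not at hb
    obtain ⟨i, hi⟩ := hb
    split_ifs at hi with hie
    · rw [Finset.prod_eq_zero (Finset.mem_univ i), zero_mul]
      simp [q, hie, hi]
    · have : b i ≤ ∑ i, b i :=
        Finset.single_le_sum (fun _ _ => Nat.zero_le _) (Finset.mem_univ i)
      rw [show φ b = 0 from if_neg (by omega), mul_zero]
  have hdiff := hfin.sub (hgeom.mul_right ((1 - p z) * ((n : ℝ) - (∑ i, k i : ℕ) + 1)))
  have hbound : ∀ b : Fin ℓ → ℕ, ‖(∏ i, q i ^ b i) * φ b -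
      (∏ i, q i ^ b i) * ((1 - p z) * ((n : ℝ) - (∑ i, k i : ℕ) + 1))‖ ≤
      ∏ i, (1 + (b i : ℝ)) * q i ^ b i := by
    intro b
    have hw : 0 ≤ ∏ i, q i ^ b i := Finset.prod_nonneg fun i _ => pow_nonneg (hq0 i) _
    rw [← mul_sub, norm_mul, Real.norm_of_nonneg hw, Finset.prod_mul_distrib, mul_comm]
    refine mul_le_mul_of_nonneg_right ?_ hw
    refine (abs_start_weight_sub_le (by linarith) (by linarith [hp z]) hn _).trans ?_
    exact_mod_cast one_add_sum_le_prod_one_add Finset.univ b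
  have hle := tsum_of_norm_bounded hdom.hasSum hbound
  rw [hdiff.tsum_eq, Real.norm_eq_abs] at hle
  rw [ewt_eq_sum hk hsum z rfl, div_eq_mul_inv, ← hmid]
  calc _ = |(∏ i, p i ^ k i) * (∑ b ∈ excess ℓ n, (∏ i, p i ^ b i) * φ b -
        (∏ i, (1 - q i)⁻¹) * ((1 - p z) * ((n : ℝ) - (∑ i, k i : ℕ) + 1)))| := by
        congr 1; ring
    _ ≤ _ := by
        rw [abs_mul, abs_of_nonneg hP]
        exact mul_le_mul_of_nonneg_left hle hP
end
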